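/- arXiv:0808.1281 — 7 statements merged into one kernel-verified Lean document; each statement's English description precedes it below -/
import Mathlib

section
/- For all real numbers a < b < 0 and every real m < b − a, there exists an infinitely differentiable function H : ℝ⁴ → ℝ admitting a global Hamiltonian flow Φ such that the time-one map ψ = Φ(1, ·) is a symplectomorphism of ℝ⁴ satisfying: ψ(x₁, x₂, y₁, y₂) = (x₁, x₂, y₁, y₂) whenever y₂ ≥ b, and ψ(x₁, x₂, y₁, y₂) = (x₁, x₂, y₁, y₂ + m) whenever y₂ ≤ a. (Lemma: level-shifting Hamiltonian diffeomorphism.) -/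
noncomputable section

/-- ℝ⁴ with coordinates (x₁, x₂, y₁, y₂). -/
abbrev R4 := ℝ × ℝ × ℝ × ℝ
/-- ℝ² with coordinates (x₁, y₁). -/
abbrev R2 := ℝ × ℝ
/-- ℝ³ with coordinates (x₁, x₂, y₁). -/
abbrev R3 := ℝ × ℝ × ℝ

/-- The standard symplectic form ω(u,v) = u₁v₃ − u₃v₁ + u₂v₄ − u₄v₂ on ℝ⁴. -/
def omega4 (u v : R4) : ℝ :=
  u.1 * v.2.2.1 - u.2.2.1 * v.1 + u.2.1 * v.2.2.2 - u.2.2.2 * v.2.1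

/-- A symplectomorphism of ℝ⁴. -/
def IsSymplectomorphism (ψ : R4 → R4) : Prop :=
  Function.Bijective ψ ∧ ContDiff ℝ (⊤ : ℕ∞) ψ ∧ ContDiff ℝ (⊤ : ℕ∞) (Function.invFun ψ) ∧
  ∀ p u v : R4, omega4 (fderiv ℝ ψ p u) (fderiv ℝ ψ p v) = omega4 u v

/-- The Hamiltonian vector field of H : ℝ⁴ → ℝ, coordinates (x₁, x₂, y₁, y₂). -/
def HamVF (H : R4 → ℝ) (p : R4) : R4 :=
  (fderiv ℝ H p (0, 0, 1, 0), fderiv ℝ H p (0, 0, 0, 1),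
   -fderiv ℝ H p (1, 0, 0, 0), -fderiv ℝ H p (0, 1, 0, 0))

/-- A global Hamiltonian flow of H on ℝ⁴. -/
def IsHamFlow (H : R4 → ℝ) (Φ : ℝ × R4 → R4) : Prop :=
  ContDiff ℝ (⊤ : ℕ∞) Φ ∧ (∀ p, Φ (0, p) = p) ∧
  ∀ (t : ℝ) (p : R4), HasDerivAt (fun s => Φ (s, p)) (HamVF H (Φ (t, p))) t

/-- A parametrization of a flat-at-infinity planar Lagrangian. -/
def IsFlatParam (f : R2 → R4) : Prop :=
  ContDiff ℝ (⊤ : ℕ∞) f ∧ Function.Injective f ∧ IsProperMap f ∧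
  (∀ p : R2, Function.Injective (fderiv ℝ f p)) ∧
  (∀ (p : R2) (u v : R2), omega4 (fderiv ℝ f p u) (fderiv ℝ f p v) = 0) ∧
  ∃ K : Set R2, IsCompact K ∧ ∀ p : R2, p ∉ K → f p = (p.1, p.2, 0, 0)

/-- A flat-at-infinity planar Lagrangian. -/
def IsFlatLagrangian (L : Set R4) : Prop :=
  ∃ f : R2 → R4, IsFlatParam f ∧ Set.range f = L

/-- `L` is transverse to the hyperplane {y₂ = a}. -/
def TransverseAt (L : Set R4) (a : ℝ) : Prop :=
  ∃ f : R2 → R4, IsFlatParam f ∧ Set.range f = L ∧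
    ∀ p : R2, (f p).2.2.2 = a → fderiv ℝ (fun q => (f q).2.2.2) p ≠ 0

/-- An area-preserving diffeomorphism of ℝ². -/
def IsAreaDiffeo (φ : R2 → R2) : Prop :=
  Function.Bijective φ ∧ ContDiff ℝ (⊤ : ℕ∞) φ ∧ ContDiff ℝ (⊤ : ℕ∞) (Function.invFun φ) ∧
  ∀ p : R2, LinearMap.det ((fderiv ℝ φ p) : R2 →ₗ[ℝ] R2) = 1

/-- φ equals the identity outside a compact set. -/
def IsCompactSupported (φ : R2 → R2) : Prop :=
  ∃ K : Set R2, IsCompact K ∧ ∀ p : R2, p ∉ K → φ p = p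

/-- φ × id : ℝ³ → ℝ³. -/
def phiTimesId (φ : R2 → R2) (p : R3) : R3 :=
  ((φ (p.1, p.2.2)).1, p.2.1, (φ (p.1, p.2.2)).2)

/-- The inclusion i_a : ℝ³ → ℝ⁴. -/
def iMap (a : ℝ) (p : R3) : R4 := (p.1, p.2.1, p.2.2, a)

/-- S ◁ S' : strict Lagrange cobordism relation. -/
def SliceRelStrict (S S' : Set R3) : Prop :=
  ∃ (L : Set R4) (a b : ℝ), a < b ∧ b < 0 ∧ IsFlatLagrangian L ∧
    TransverseAt L a ∧ TransverseAt L b ∧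
    L ∩ {p : R4 | p.2.2.2 = a} = iMap a '' S ∧
    L ∩ {p : R4 | p.2.2.2 = b} = iMap b '' S'

/-- S ⊴ S' : non-strict Lagrange cobordism relation. -/
def SliceRel (S S' : Set R3) : Prop :=
  ∃ (L : Set R4) (a b : ℝ), a ≤ b ∧ b < 0 ∧ IsFlatLagrangian L ∧
    TransverseAt L a ∧ TransverseAt L b ∧
    L ∩ {p : R4 | p.2.2.2 = a} = iMap a '' S ∧
    L ∩ {p : R4 | p.2.2.2 = b} = iMap b '' S'

/-- S ∼ S' : equivalence of slices. -/
def SliceEquiv (S S' : Set R3) : Prop :=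
  ∃ φ : R2 → R2, IsAreaDiffeo φ ∧ IsCompactSupported φ ∧ phiTimesId φ '' S = S'

/-- A negative slice. -/
def IsNegativeSlice (S : Set R3) : Prop :=
  ∃ (L : Set R4) (a : ℝ), a < 0 ∧ IsFlatLagrangian L ∧ TransverseAt L a ∧
    L ∩ {p : R4 | p.2.2.2 = a} = iMap a '' S
/-- Time-dependent Hamiltonian vector field on ℝ⁴. -/
def HamVF4t (H : ℝ × R4 → ℝ) (t : ℝ) (p : R4) : R4 :=
  (fderiv ℝ (fun q => H (t, q)) p (0, 0, 1, 0),
   fderiv ℝ (fun q => H (t, q)) p (0, 0, 0, 1),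
   -fderiv ℝ (fun q => H (t, q)) p (1, 0, 0, 0),
   -fderiv ℝ (fun q => H (t, q)) p (0, 1, 0, 0))

/-- A global Hamiltonian flow of a time-dependent Hamiltonian on ℝ⁴. -/
def IsHamFlow4t (H : ℝ × R4 → ℝ) (Φ : ℝ × R4 → R4) : Prop :=
  ContDiff ℝ (⊤ : ℕ∞) Φ ∧ (∀ p, Φ (0, p) = p) ∧
  ∀ (t : ℝ) (p : R4), HasDerivAt (fun s => Φ (s, p)) (HamVF4t H t (Φ (t, p))) t

/-- Time-dependent Hamiltonian vector field on ℝ², coordinates (x₁, y₁). -/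
def HamVF2t (H : ℝ × R2 → ℝ) (t : ℝ) (q : R2) : R2 :=
  (fderiv ℝ (fun r => H (t, r)) q (0, 1), -fderiv ℝ (fun r => H (t, r)) q (1, 0))

/-- A global Hamiltonian flow of a time-dependent Hamiltonian on ℝ². -/
def IsHamFlow2t (H : ℝ × R2 → ℝ) (φ : ℝ × R2 → R2) : Prop :=
  ContDiff ℝ (⊤ : ℕ∞) φ ∧ (∀ q, φ (0, q) = q) ∧
  ∀ (t : ℝ) (q : R2), HasDerivAt (fun s => φ (s, q)) (HamVF2t H t (φ (t, q))) t

/-- Translation of ℝ⁴ by s in the x₁-direction. -/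
def trX1 (s : ℝ) (p : R4) : R4 := (p.1 + s, p.2.1, p.2.2.1, p.2.2.2)

/-- Φ_φ : ℝ⁴ → ℝ⁴ induced by an area-preserving diffeomorphism φ of the x₁y₁-plane. -/
def PhiPhi (φ : R2 → R2) (p : R4) : R4 :=
  ((φ (p.1, p.2.2.1)).1, p.2.1, (φ (p.1, p.2.2.1)).2, p.2.2.2)

open Filter Topology in
/-- A smooth one-parameter group on the line fixing `z ≤ 0` and translating for `z ≥ d`. -/
theorem exists_line_flow (d : ℝ) (hd : 0 < d) :
    ∃ F : ℝ × ℝ → ℝ, ContDiff ℝ (⊤ : ℕ∞) F ∧ (∀ z, F (0, z) = z) ∧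
      (∀ s t z, F (s + t, z) = F (s, F (t, z))) ∧
      (∀ s z, z ≤ 0 → F (s, z) = z) ∧
      (∀ s z, d ≤ z → d ≤ z - s → F (s, z) = z - s) := by
  set σ : ℝ → ℝ := fun z => Real.smoothTransition (2 / d * z - 1) with hσ
  have hσs : ContDiff ℝ (⊤ : ℕ∞) σ :=
    Real.smoothTransition.contDiff.comp (by fun_prop)
  have hσm : Monotone σ := by
    intro x y h
    apply Real.smoothTransition.monotone
    have : 0 < 2 / d := by positivity
    nlinarith
  have hσ0 : ∀ z, z ≤ d / 2 → σ z = 0 := by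
    intro z hz
    apply Real.smoothTransition.zero_of_nonpos
    rw [div_mul_eq_mul_div, sub_nonpos, div_le_one hd]; linarith
  have hσ1 : ∀ z, d ≤ z → σ z = 1 := by
    intro z hz
    apply Real.smoothTransition.one_of_one_le
    have : 2 ≤ 2 / d * z := by
      rw [div_mul_eq_mul_div, le_div_iff₀ hd]; linarith
    linarith
  have hσn : ∀ z, 0 ≤ σ z := fun z => Real.smoothTransition.nonneg _
  have hσl : ∀ z, σ z ≤ 1 := fun z => Real.smoothTransition.le_one _
  set G : ℝ → ℝ := fun z => (1 - σ z) * Real.exp z⁻¹ - σ z * z with hG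
  have hG0 : ∀ z, z ≤ d / 2 → G z = Real.exp z⁻¹ := by
    intro z hz; simp [hG, hσ0 z hz]
  have hG1 : ∀ z, d ≤ z → G z = -z := by
    intro z hz; simp [hG, hσ1 z hz]
  have hGs : ∀ z, 0 < z → ContDiffAt ℝ (⊤ : ℕ∞) G z := by
    intro z hz
    have h1 : ContDiffAt ℝ (⊤ : ℕ∞) (fun z : ℝ => z⁻¹) z := contDiffAt_inv ℝ hz.ne'
    have h2 := hσs.contDiffAt (x := z)
    exact ((contDiffAt_const.sub h2).mul h1.exp).sub (h2.mul contDiffAt_id)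
  have hGd : ∀ z, 0 < z → ∃ g' < 0, HasDerivAt G g' z := by
    intro z hz
    have h2 : HasDerivAt σ (deriv σ z) z :=
      ((hσs.differentiable (by simp)) z).hasDerivAt
    have h1 := (hasDerivAt_inv hz.ne').exp
    have h3 := ((h2.const_sub 1).mul h1).sub (h2.mul (hasDerivAt_id z))
    refine ⟨_, ?_, h3⟩
    have h4 : 0 ≤ deriv σ z := hσm.deriv_nonneg
    have e := Real.exp_pos z⁻¹
    have hz2 : 0 < (z ^ 2)⁻¹ := by positivity
    have h5 : 0 ≤ deriv σ z * Real.exp z⁻¹ := by positivity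
    have h6 : 0 ≤ deriv σ z * z := by positivity
    have h7 : 0 < (1 - σ z) * (Real.exp z⁻¹ * (z ^ 2)⁻¹) + σ z := by
      have h8 : 0 < Real.exp z⁻¹ * (z ^ 2)⁻¹ := by positivity
      rcases (hσn z).eq_or_lt with h | h
      · rw [← h]; simpa using h8
      · have := mul_nonneg (sub_nonneg.2 (hσl z)) h8.le
        linarith
    simp only [id]
    nlinarith
  have hGanti : StrictAntiOn G (Set.Ioi 0) := by
    apply strictAntiOn_of_deriv_neg (convex_Ioi 0)
    · intro z hz; exact (hGs z hz).continuousAt.continuousWithinAt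
    · intro z hz
      rw [interior_Ioi] at hz
      obtain ⟨g', h, h'⟩ := hGd z hz
      rwa [h'.deriv]
  have hsurj : ∀ w, ∃ z, 0 < z ∧ G z = w := by
    intro w
    set z1 := min (d / 2) (|w| + 1)⁻¹ with hz1
    set z2 := max d |w| with hz2
    have p1 : 0 < z1 := by positivity
    have l12 : z1 ≤ z2 := by
      have := min_le_left (d / 2) (|w| + 1)⁻¹
      have := le_max_left d |w|
      linarith
    have hc : ContinuousOn G (Set.Icc z1 z2) := fun z hz =>
      (hGs z (p1.trans_le hz.1)).continuousAt.continuousWithinAt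
    have g1 : w ≤ G z1 := by
      rw [hG0 z1 (min_le_left _ _)]
      have h1 : |w| + 1 ≤ z1⁻¹ := by
        rw [le_inv_comm₀ (by positivity) p1]; exact min_le_right _ _
      have := Real.add_one_le_exp z1⁻¹
      have := le_abs_self w
      linarith
    have g2 : G z2 ≤ w := by
      rw [hG1 z2 (le_max_left _ _)]
      have := le_max_right d |w|
      have := neg_abs_le w
      linarith
    obtain ⟨z, hz, h⟩ := intermediate_value_Icc' l12 hc ⟨g2, g1⟩
    exact ⟨z, p1.trans_le hz.1, h⟩
  choose K hK0 hGK using hsurj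
  have hKG : ∀ z, 0 < z → K (G z) = z := fun z hz =>
    hGanti.injOn (hK0 _) hz (hGK _)
  have hKs : ContDiff ℝ (⊤ : ℕ∞) K := by
    rw [contDiff_iff_contDiffAt]
    intro w
    obtain ⟨g', hg, hg'⟩ := hGd (K w) (hK0 w)
    have hf' : HasFDerivAt G ((ContinuousLinearEquiv.unitsEquivAut ℝ (Units.mk0 g' hg.ne) :
        ℝ ≃L[ℝ] ℝ) : ℝ →L[ℝ] ℝ) (K w) := by
      rw [hasDerivAt_iff_hasFDerivAt] at hg'
      refine hg'.congr_fderiv ?_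
      ext; simp
    have hc := hGs (K w) (hK0 w)
    have h1 := hc.to_localInverse hf' (by simp)
    rw [hGK] at h1
    refine h1.congr_of_eventuallyEq ?_
    have h2 := (hc.hasStrictFDerivAt' hf' (by simp)).localInverse_unique (g := K)
      (by filter_upwards [lt_mem_nhds (hK0 w)] with x hx using hKG x hx)
    rw [hGK] at h2
    exact h2
  refine ⟨fun q => if q.2 ≤ 0 then q.2 else K (G q.2 + q.1), ?_, ?_, ?_, ?_, ?_⟩
  · rw [contDiff_iff_contDiffAt]
    rintro ⟨s0, z0⟩
    rcases lt_trichotomy z0 0 with hz | hz | hz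
    · have : ContDiffAt ℝ (⊤ : ℕ∞) (fun q : ℝ × ℝ => q.2) (s0, z0) := contDiffAt_snd
      refine this.congr_of_eventuallyEq ?_
      have : ∀ᶠ q : ℝ × ℝ in 𝓝 (s0, z0), q.2 < 0 :=
        continuousAt_snd.eventually (gt_mem_nhds hz)
      filter_upwards [this] with q hq
      rw [if_pos hq.le]
    · subst hz
      have hA : ContDiff ℝ (⊤ : ℕ∞) (fun q : ℝ × ℝ => 1 + q.1 * expNegInvGlue q.2) :=
        contDiff_const.add (contDiff_fst.mul (expNegInvGlue.contDiff.comp contDiff_snd))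
      have hB : ContDiffAt ℝ (⊤ : ℕ∞)
          (fun q : ℝ × ℝ => 1 + q.2 * Real.log (1 + q.1 * expNegInvGlue q.2)) (s0, 0) :=
        contDiffAt_const.add (contDiffAt_snd.mul (hA.contDiffAt.log (by simp)))
      have hC : ContDiffAt ℝ (⊤ : ℕ∞)
          (fun q : ℝ × ℝ => q.2 / (1 + q.2 * Real.log (1 + q.1 * expNegInvGlue q.2))) (s0, 0) :=
        contDiffAt_snd.div hB (by simp)
      refine hC.congr_of_eventuallyEq ?_
      have eA := hA.continuous.continuousAt.eventually (lt_mem_nhds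
        (show (0 : ℝ) < 1 + (s0, (0 : ℝ)).1 * expNegInvGlue (s0, (0 : ℝ)).2 by simp))
      have eB := hB.continuousAt.eventually (lt_mem_nhds
        (show (0 : ℝ) < 1 + (s0, (0 : ℝ)).2 *
          Real.log (1 + (s0, (0 : ℝ)).1 * expNegInvGlue (s0, (0 : ℝ)).2) by simp))
      have eC := hC.continuousAt.eventually (gt_mem_nhds
        (show _ < d / 2 by simpa using hd))
      have eD : ∀ᶠ q : ℝ × ℝ in 𝓝 (s0, 0), q.2 < d / 2 :=
        continuousAt_snd.eventually (gt_mem_nhds (by simpa using hd))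
      filter_upwards [eA, eB, eC, eD] with q hA hB hC hD
      split_ifs with h
      · simp [expNegInvGlue.zero_of_nonpos h]
      · push Not at h
        have hR0 := div_pos h hB
        rw [← hKG _ hR0, hG0 _ hC.le, hG0 _ hD.le]
        congr 1
        have e1 : (q.2 / (1 + q.2 * Real.log (1 + q.1 * expNegInvGlue q.2)))⁻¹ =
            q.2⁻¹ + Real.log (1 + q.1 * expNegInvGlue q.2) := by
          rw [inv_div]; field_simp
        rw [e1, Real.exp_add, Real.exp_log hA]
        have e2 : expNegInvGlue q.2 = Real.exp (-q.2⁻¹) := by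
          simp [expNegInvGlue, h]
        rw [e2, Real.exp_neg]
        field_simp
    · have h1 : ContDiffAt ℝ (⊤ : ℕ∞) (fun q : ℝ × ℝ => K (G q.2 + q.1)) (s0, z0) :=
        hKs.contDiffAt.comp _
          (((hGs z0 hz).comp (s0, z0) (f := Prod.snd) contDiffAt_snd).add contDiffAt_fst)
      refine h1.congr_of_eventuallyEq ?_
      have : ∀ᶠ q : ℝ × ℝ in 𝓝 (s0, z0), 0 < q.2 :=
        continuousAt_snd.eventually (lt_mem_nhds hz)
      filter_upwards [this] with q hq
      rw [if_neg hq.not_ge]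
  · intro z
    dsimp only
    split_ifs with h
    · rfl
    · rw [add_zero, hKG z (not_le.1 h)]
  · intro s t z
    dsimp only
    by_cases h : z ≤ 0
    · simp [h]
    · simp only [h, if_false, (hK0 _).not_ge, hGK]
      congr 1; ring
  · intro s z h
    simp [h]
  · intro s z h h'
    have : ¬ z ≤ 0 := by linarith
    simp only [this, if_false]
    rw [hG1 z h, ← hKG (z - s) (by linarith), hG1 _ h']
    congr 1; ring

set_option maxHeartbeats 1000000 in
/-- The cotangent lift of a smooth one-parameter group on the `y₂`-line. -/
theorem lift_flow (f : ℝ × ℝ → ℝ) (hf : ContDiff ℝ (⊤ : ℕ∞) f) (h0 : ∀ y, f (0, y) = y)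
    (hadd : ∀ s t y, f (s + t, y) = f (s, f (t, y))) :
    ∃ (H : R4 → ℝ) (Φ : ℝ × R4 → R4),
      ContDiff ℝ (⊤ : ℕ∞) H ∧ IsHamFlow H Φ ∧
      IsSymplectomorphism (fun p => Φ (1, p)) ∧
      (∀ t p, Φ (t, p) =
        (p.1, p.2.1 / deriv (fun y => f (t, y)) p.2.2.2, p.2.2.1, f (t, p.2.2.2))) := by
  have hfd : ∀ q, HasFDerivAt f (fderiv ℝ f q) q := fun q =>
    ((hf.differentiable (by simp)) q).hasFDerivAt
  set fy : ℝ × ℝ → ℝ := fun q => fderiv ℝ f q (0, 1) with hfy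
  set ft : ℝ × ℝ → ℝ := fun q => fderiv ℝ f q (1, 0) with hft
  have hf1 : ContDiff ℝ (⊤ : ℕ∞) (fderiv ℝ f) := hf.fderiv_right (by simp)
  have hfys : ContDiff ℝ (⊤ : ℕ∞) fy := hf1.clm_apply contDiff_const
  have hfts : ContDiff ℝ (⊤ : ℕ∞) ft := hf1.clm_apply contDiff_const
  have cy : ∀ t y : ℝ, HasDerivAt (fun y => ((t, y) : ℝ × ℝ)) (0, 1) y := fun t y =>
    (hasDerivAt_const y t).prodMk (hasDerivAt_id y)
  have ct : ∀ t y : ℝ, HasDerivAt (fun t => ((t, y) : ℝ × ℝ)) (1, 0) t := fun t y =>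
    (hasDerivAt_id t).prodMk (hasDerivAt_const t y)
  have dy : ∀ t y, HasDerivAt (fun y => f (t, y)) (fy (t, y)) y := fun t y =>
    (hfd (t, y)).comp_hasDerivAt y (cy t y)
  have dt : ∀ t y, HasDerivAt (fun t => f (t, y)) (ft (t, y)) t := fun t y =>
    (hfd (t, y)).comp_hasDerivAt t (ct t y)
  have hne : ∀ q, fy q ≠ 0 := by
    rintro ⟨t, y⟩ h
    have h1 := (dy (-t) (f (t, y))).comp y (dy t y)
    have h2 : (fun y => f (-t, y)) ∘ (fun y => f (t, y)) = id := by
      funext z; simp [← hadd, h0]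
    rw [h2, h, mul_zero] at h1
    exact zero_ne_one (h1.unique (hasDerivAt_id y))
  set χ : ℝ → ℝ := fun y => ft (0, y) with hχ
  have hχs : ContDiff ℝ (⊤ : ℕ∞) χ := hfts.comp (contDiff_const.prodMk contDiff_id)
  have hχd : ∀ y, HasDerivAt χ (deriv χ y) y := fun y =>
    ((hχs.differentiable (by simp)) y).hasDerivAt
  have hflow : ∀ t y, ft (t, y) = χ (f (t, y)) := by
    intro t y
    have h1 : HasDerivAt (fun s => f (s + t, y)) (ft (0 + t, y)) 0 :=
      (dt (0 + t) y).comp_add_const 0 t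
    simp only [hadd, zero_add] at h1
    exact h1.unique (dt 0 (f (t, y)))
  -- variational equation
  have hvar : ∀ t y, HasDerivAt (fun t => fy (t, y)) (deriv χ (f (t, y)) * fy (t, y)) t := by
    intro t y
    have hf2 : HasFDerivAt (fderiv ℝ f) (fderiv ℝ (fderiv ℝ f) (t, y)) (t, y) :=
      ((hf1.differentiable (by simp)) _).hasFDerivAt
    have k : ∀ v : ℝ × ℝ, HasFDerivAt (fun q => fderiv ℝ f q v)
        ((ContinuousLinearMap.apply ℝ ℝ v).comp (fderiv ℝ (fderiv ℝ f) (t, y))) (t, y) := fun v =>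
      (ContinuousLinearMap.apply ℝ ℝ v).hasFDerivAt.comp (t, y) hf2
    have h1 : HasDerivAt (fun t => fy (t, y)) (fderiv ℝ (fderiv ℝ f) (t, y) (1, 0) (0, 1)) t := by
      have := (k (0, 1)).comp_hasDerivAt t (ct t y)
      exact this
    have h2 : HasDerivAt (fun y => ft (t, y)) (fderiv ℝ (fderiv ℝ f) (t, y) (0, 1) (1, 0)) y :=
      (k (1, 0)).comp_hasDerivAt y (cy t y)
    have hs : IsSymmSndFDerivAt ℝ f (t, y) :=
      hf.contDiffAt.isSymmSndFDerivAt (by simp; exact WithTop.coe_le_coe.2 (le_top : (2 : ℕ∞) ≤ ⊤))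
    have h3 : HasDerivAt (fun y => ft (t, y)) (deriv χ (f (t, y)) * fy (t, y)) y := by
      simp only [hflow]
      exact (hχd (f (t, y))).comp y (dy t y)
    rw [← h2.unique h3, ← hs.eq]
    exact h1
  have hcomp : ∀ s t y, fy (s + t, y) = fy (s, f (t, y)) * fy (t, y) := by
    intro s t y
    have h1 := (dy s (f (t, y))).comp y (dy t y)
    have h2 : (fun y => f (s, y)) ∘ (fun y => f (t, y)) = fun y => f (s + t, y) := by
      funext z; simp [hadd]
    rw [h2] at h1
    exact (dy (s + t) y).unique h1
  have hfy0 : ∀ y, fy (0, y) = 1 := by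
    intro y
    have := dy 0 y
    simp only [h0] at this
    exact this.unique (hasDerivAt_id y)
  set Φ : ℝ × R4 → R4 := fun q =>
    (q.2.1, q.2.2.1 / fy (q.1, q.2.2.2.2), q.2.2.2.1, f (q.1, q.2.2.2.2)) with hΦ
  have c4 : ContDiff ℝ (⊤ : ℕ∞) (fun q : ℝ × R4 => (q.1, q.2.2.2.2)) := by fun_prop
  have hΦs : ContDiff ℝ (⊤ : ℕ∞) Φ := by
    have a1 : ContDiff ℝ (⊤ : ℕ∞) (fun q : ℝ × R4 => q.2.1) := by fun_prop
    have a2 : ContDiff ℝ (⊤ : ℕ∞) (fun q : ℝ × R4 => q.2.2.1) := by fun_prop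
    have a3 : ContDiff ℝ (⊤ : ℕ∞) (fun q : ℝ × R4 => q.2.2.2.1) := by fun_prop
    exact a1.prodMk ((a2.div (hfys.comp c4) (fun q => hne _)).prodMk
      (a3.prodMk (hf.comp c4)))
  have hΦ0 : ∀ p, Φ (0, p) = p := by
    rintro ⟨x1, x2, y1, y2⟩; simp [hΦ, h0, hfy0]
  have hΦadd : ∀ s t p, Φ (s + t, p) = Φ (s, Φ (t, p)) := by
    rintro s t ⟨x1, x2, y1, y2⟩
    simp only [hΦ, hadd, hcomp, Prod.mk.injEq, true_and, and_true]
    rw [div_div, mul_comm]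
  have hs1 : ∀ t, ContDiff ℝ (⊤ : ℕ∞) (fun p => Φ (t, p)) := fun t =>
    hΦs.comp (contDiff_const.prodMk contDiff_id)
  have hbij : Function.Bijective (fun p => Φ (1, p)) := by
    refine Function.bijective_iff_has_inverse.2 ⟨fun p => Φ (-1, p), fun p => ?_, fun p => ?_⟩
    · simp [← hΦadd, hΦ0]
    · simp [← hΦadd, hΦ0]
  refine ⟨fun p => -(p.2.1 * χ p.2.2.2), Φ, ?_, ⟨hΦs, hΦ0, ?_⟩, ⟨hbij, hs1 1, ?_, ?_⟩, ?_⟩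
  · have a2 : ContDiff ℝ (⊤ : ℕ∞) (fun q : R4 => q.2.1) := by fun_prop
    have a3 : ContDiff ℝ (⊤ : ℕ∞) (fun q : R4 => q.2.2.2) := by fun_prop
    exact (a2.mul (hχs.comp a3)).neg
  · rintro t ⟨x1, x2, y1, y2⟩
    have hH : ∀ p : R4, ∀ u : R4, fderiv ℝ (fun p : R4 => -(p.2.1 * χ p.2.2.2)) p u =
        -(p.2.1 * (deriv χ p.2.2.2 * u.2.2.2) + χ p.2.2.2 * u.2.1) := by
      intro p u
      have a2 : HasFDerivAt (fun q : R4 => q.2.1) _ p :=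
      ((ContinuousLinearMap.fst ℝ ℝ (ℝ × ℝ)).comp (ContinuousLinearMap.snd ℝ ℝ (ℝ × ℝ × ℝ))).hasFDerivAt
      have a3 : HasFDerivAt (fun q : R4 => q.2.2.2) _ p :=
      ((ContinuousLinearMap.snd ℝ ℝ ℝ).comp ((ContinuousLinearMap.snd ℝ ℝ (ℝ × ℝ)).comp (ContinuousLinearMap.snd ℝ ℝ (ℝ × ℝ × ℝ)))).hasFDerivAt
      have := (a2.mul ((hχd p.2.2.2).comp_hasFDerivAt p a3)).neg
      have e : fderiv ℝ (fun p : R4 => -(p.2.1 * χ p.2.2.2)) p = _ := this.fderiv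
      rw [e]
      simp
    have e : HamVF (fun p : R4 => -(p.2.1 * χ p.2.2.2)) (Φ (t, (x1, x2, y1, y2))) =
        (0, -(x2 * (deriv χ (f (t, y2)) * fy (t, y2)) / fy (t, y2) ^ 2), 0, ft (t, y2)) := by
      have := hne (t, y2)
      simp only [HamVF, hH, hΦ, hflow]
      ext <;> simp
      field_simp
    rw [e]
    have b2 := (hasDerivAt_const t x2).div (hvar t y2) (hne (t, y2))
    refine (hasDerivAt_const t x1).prodMk (HasDerivAt.prodMk ?_
      ((hasDerivAt_const t y1).prodMk (dt t y2)))
    refine b2.congr_deriv ?_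
    ring
  · have : Function.invFun (fun p => Φ (1, p)) = fun p => Φ (-1, p) := by
      funext p
      apply hbij.1
      rw [Function.rightInverse_invFun hbij.2 p]
      simp [← hΦadd, hΦ0]
    rw [this]
    exact hs1 (-1)
  · intro p u v
    have hg : ContDiff ℝ (⊤ : ℕ∞) (fun y => fy (1, y)) :=
      hfys.comp (contDiff_const.prodMk contDiff_id)
    have hgd := ((hg.differentiable (by simp)) p.2.2.2).hasDerivAt
    have a1 : HasFDerivAt (fun q : R4 => q.1) _ p :=
      (ContinuousLinearMap.fst ℝ ℝ (ℝ × ℝ × ℝ)).hasFDerivAt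
    have a2 : HasFDerivAt (fun q : R4 => q.2.1) _ p :=
      ((ContinuousLinearMap.fst ℝ ℝ (ℝ × ℝ)).comp (ContinuousLinearMap.snd ℝ ℝ (ℝ × ℝ × ℝ))).hasFDerivAt
    have a3 : HasFDerivAt (fun q : R4 => q.2.2.1) _ p :=
      ((ContinuousLinearMap.fst ℝ ℝ ℝ).comp ((ContinuousLinearMap.snd ℝ ℝ (ℝ × ℝ)).comp (ContinuousLinearMap.snd ℝ ℝ (ℝ × ℝ × ℝ)))).hasFDerivAt
    have a4 : HasFDerivAt (fun q : R4 => q.2.2.2) _ p :=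
      ((ContinuousLinearMap.snd ℝ ℝ ℝ).comp ((ContinuousLinearMap.snd ℝ ℝ (ℝ × ℝ)).comp (ContinuousLinearMap.snd ℝ ℝ (ℝ × ℝ × ℝ)))).hasFDerivAt
    have b := a1.prodMk ((a2.mul ((hgd.inv (hne _)).comp_hasFDerivAt p a4)).prodMk
      (a3.prodMk ((dy 1 p.2.2.2).comp_hasFDerivAt p a4)))
    have hψ : (fun p => Φ (1, p)) = fun q : R4 => (q.1, q.2.1 * (fy (1, q.2.2.2))⁻¹, q.2.2.1,
        f (1, q.2.2.2)) := by
      funext q; simp [hΦ, div_eq_mul_inv]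
    have e : fderiv ℝ (fun q : R4 => ((q.1, q.2.1 * (fy (1, q.2.2.2))⁻¹, q.2.2.1,
        f (1, q.2.2.2)) : R4)) p = _ := b.fderiv
    rw [hψ, e]
    have := hne (1, p.2.2.2)
    simp [omega4]
    field_simp
    ring
  · intro t p
    rw [(dy t p.2.2.2).deriv]

theorem deriv_one_of_eqOn {f : ℝ → ℝ} {S : Set ℝ} {y c : ℝ} (hf : DifferentiableAt ℝ f y)
    (hS : UniqueDiffWithinAt ℝ S y) (hy : y ∈ S) (h : ∀ z ∈ S, f z = z + c) :
    deriv f y = 1 := by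
  have h1 : HasDerivWithinAt f (deriv f y) S y := hf.hasDerivAt.hasDerivWithinAt
  have h2 : HasDerivWithinAt f 1 S y :=
    (((hasDerivAt_id y).add_const c).hasDerivWithinAt).congr h (h y hy)
  exact hS.eq_deriv S h1 h2

/-- Level-shifting Hamiltonian diffeomorphism. -/
theorem level_shift (a b m : ℝ) (hab : a < b) (hb0 : b < 0) (hm : m < b - a) :
    ∃ (H : R4 → ℝ) (Φ : ℝ × R4 → R4),
      ContDiff ℝ (⊤ : ℕ∞) H ∧ IsHamFlow H Φ ∧
      IsSymplectomorphism (fun p => Φ (1, p)) ∧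
      (∀ p : R4, b ≤ p.2.2.2 → Φ (1, p) = p) ∧
      (∀ p : R4, p.2.2.2 ≤ a → Φ (1, p) = (p.1, p.2.1, p.2.2.1, p.2.2.2 + m)) := by
  obtain ⟨d, hd, hd1, hd2⟩ : ∃ d : ℝ, 0 < d ∧ d < b - a ∧ d < b - a - m := by
    obtain ⟨d, h1, h2⟩ := exists_between (show 0 < min (b - a) (b - a - m) from
      lt_min (by linarith) (by linarith))
    exact ⟨d, h1, h2.trans_le (min_le_left _ _), h2.trans_le (min_le_right _ _)⟩
  obtain ⟨F, hF, hF0, hFadd, hFfix, hFtr⟩ := exists_line_flow d hd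
  obtain ⟨H, Φ, hH, hflow, hsymp, hform⟩ := lift_flow (fun q => b - F (m * q.1, b - q.2))
    (contDiff_const.sub (hF.comp (by fun_prop))) (fun y => by simp [hF0])
    (fun s t y => by simp [mul_add, hFadd])
  have hdiff : ∀ y, DifferentiableAt ℝ (fun y => b - F (m * 1, b - y)) y := by
    intro y
    have : ContDiff ℝ (⊤ : ℕ∞) (fun y => b - F (m * 1, b - y)) :=
      contDiff_const.sub (hF.comp (by fun_prop))
    exact (this.differentiable (by simp)) y
  have e1 : ∀ y ∈ Set.Ici b, b - F (m * 1, b - y) = y + 0 := by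
    intro y hy
    have hy' : b ≤ y := hy
    rw [hFfix _ _ (by linarith)]; ring
  have e2 : ∀ y ∈ Set.Iic a, b - F (m * 1, b - y) = y + m := by
    intro y hy
    have hy' : y ≤ a := hy
    rw [hFtr _ _ (by linarith) (by linarith)]; ring
  refine ⟨H, Φ, hH, hflow, hsymp, ?_, ?_⟩
  · rintro ⟨x1, x2, y1, y2⟩ hp
    rw [hform]
    dsimp only at hp ⊢
    rw [deriv_one_of_eqOn (hdiff y2) (uniqueDiffOn_Ici b y2 hp) hp e1, e1 y2 hp]
    simp
  · rintro ⟨x1, x2, y1, y2⟩ hp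
    rw [hform]
    dsimp only at hp ⊢
    rw [deriv_one_of_eqOn (hdiff y2) (uniqueDiffOn_Iic a y2 hp) hp e2, e2 y2 hp]
    simp
end
end

section
/- For all real numbers a < b < 0 and c < d < 0, there exist a symplectomorphism ψ of ℝ⁴ and a real δ > 0 such that: ψ(p) = p for every p with y₂-coordinate ≥ 0; ψ(x₁, x₂, y₁, y₂) = (x₁, x₂, y₁, y₂ + (d − b)) whenever |y₂ − b| < δ; and ψ(x₁, x₂, y₁, y₂) = (x₁, x₂, y₁, y₂ + (c − a)) whenever y₂ < a + δ. -/
noncomputable section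

-- BEGIN
lemma aux_shift (l r w : ℝ) (hlr : l < r) (hw : 0 < w) :
    ∃ (h : ℝ → ℝ) (δ : ℝ), 0 < δ ∧ ContDiff ℝ (⊤ : ℕ∞) h ∧ (∀ y, 0 < deriv h y) ∧
      (∀ y, r - δ ≤ y → h y = y) ∧ (∀ y, y ≤ l + δ → h y = y + (r - l - w)) := by
  obtain ⟨δ, hδ, h1, h2⟩ : ∃ δ : ℝ, 0 < δ ∧ 4 * δ < w ∧ 4 * δ < r - l := by
    refine ⟨min w (r - l) / 8, ?_, ?_, ?_⟩
    · have := lt_min hw (sub_pos.2 hlr); linarith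
    · have := lt_min hw (sub_pos.2 hlr); have := min_le_left w (r - l); linarith
    · have := lt_min hw (sub_pos.2 hlr); have := min_le_right w (r - l); linarith
  let f : ContDiffBump ((l + r) / 2 : ℝ) :=
    ⟨(r - l) / 2 - 2 * δ, (r - l) / 2 - δ, by linarith, by linarith⟩
  have hfs : ContDiff ℝ (⊤ : ℕ∞) (f : ℝ → ℝ) := f.contDiff
  have hfc : Continuous (f : ℝ → ℝ) := hfs.continuous
  have hf0 : ∀ y, (y ≤ l + δ ∨ r - δ ≤ y) → f y = 0 := by
    intro y hy
    apply f.zero_of_le_dist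
    rw [Real.dist_eq]
    change (r - l) / 2 - δ ≤ _
    rcases hy with hy | hy
    · rw [abs_sub_comm]; refine le_trans ?_ (le_abs_self _); linarith
    · refine le_trans ?_ (le_abs_self _); linarith
  have hf1 : ∀ y, l + 2 * δ ≤ y → y ≤ r - 2 * δ → f y = 1 := by
    intro y hy hy'
    apply f.one_of_mem_closedBall
    rw [Metric.mem_closedBall, Real.dist_eq]
    change _ ≤ (r - l) / 2 - 2 * δ
    rw [abs_le]; constructor <;> linarith
  set I : ℝ := ∫ t in l..r, f t with hI
  have hint : ∀ u v : ℝ, IntervalIntegrable (f : ℝ → ℝ) MeasureTheory.volume u v :=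
    fun u v => hfc.intervalIntegrable u v
  have hIge : r - l - 4 * δ ≤ I := by
    have e1 : ∫ t in (l + 2 * δ)..(r - 2 * δ), f t = r - l - 4 * δ := by
      rw [intervalIntegral.integral_congr (g := fun _ => (1 : ℝ))]
      · simp; ring
      · intro t ht
        rw [Set.uIcc_of_le (by linarith)] at ht
        exact hf1 t ht.1 ht.2
    have e2 : 0 ≤ ∫ t in l..(l + 2 * δ), f t :=
      intervalIntegral.integral_nonneg (by linarith) fun t _ => f.nonneg
    have e3 : 0 ≤ ∫ t in (r - 2 * δ)..r, f t :=
      intervalIntegral.integral_nonneg (by linarith) fun t _ => f.nonneg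
    have e4 := intervalIntegral.integral_add_adjacent_intervals
      (hint l (l + 2 * δ)) (hint (l + 2 * δ) (r - 2 * δ))
    have e5 := intervalIntegral.integral_add_adjacent_intervals
      (hint l (r - 2 * δ)) (hint (r - 2 * δ) r)
    linarith
  have hI0 : 0 < I := by linarith
  set k : ℝ := (w - (r - l)) / I with hk
  have hkI : k * I = w - (r - l) := by rw [hk]; field_simp
  have hk1 : -1 < k := by
    rw [hk, lt_div_iff₀ hI0]; linarith
  have hder : ∀ y, HasDerivAt (fun y => y + k * ∫ t in r..y, f t) (1 + k * f y) y := by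
    intro y
    have := intervalIntegral.integral_hasDerivAt_right (hint r y)
      (hfc.stronglyMeasurableAtFilter _ _) hfc.continuousAt
    exact (hasDerivAt_id y).add (this.const_mul k)
  have hderiv : deriv (fun y => y + k * ∫ t in r..y, f t) = fun y => 1 + k * f y :=
    funext fun y => (hder y).deriv
  refine ⟨fun y => y + k * ∫ t in r..y, f t, δ, hδ, ?_, ?_, ?_, ?_⟩
  · rw [contDiff_infty_iff_deriv]
    refine ⟨fun y => (hder y).differentiableAt, ?_⟩
    rw [hderiv]
    exact contDiff_const.add (contDiff_const.mul hfs)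
  · intro y
    rw [hderiv]
    have a0 : 0 ≤ f y := f.nonneg
    have a1 : f y ≤ 1 := f.le_one
    show 0 < 1 + k * f y
    rcases le_or_gt 0 k with hk0 | hk0
    · have := mul_nonneg hk0 a0; linarith
    · nlinarith
  · intro y hy
    have : ∫ t in r..y, f t = 0 := by
      rw [intervalIntegral.integral_congr (g := fun _ => (0 : ℝ))]
      · simp
      · intro t ht
        refine hf0 t (Or.inr ?_)
        exact le_trans (le_min (by linarith) hy) ht.1
    simp [this]
  · intro y hy
    have e : ∫ t in l..y, f t = 0 := by
      rw [intervalIntegral.integral_congr (g := fun _ => (0 : ℝ))]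
      · simp
      · intro t ht
        refine hf0 t (Or.inl ?_)
        exact le_trans ht.2 (max_le (by linarith) hy)
    have e2 := intervalIntegral.integral_add_adjacent_intervals (hint r l) (hint l y)
    rw [intervalIntegral.integral_symm l r, e] at e2
    show y + k * (∫ t in r..y, f t) = _
    rw [← e2]
    linarith

lemma aux_symp (h : ℝ → ℝ) (hs : ContDiff ℝ (⊤ : ℕ∞) h) (hp : ∀ y, 0 < deriv h y)
    (hsurj : Function.Surjective h) :
    IsSymplectomorphism
      (fun p : R4 => (p.1, p.2.1 * (deriv h p.2.2.2)⁻¹, p.2.2.1, h p.2.2.2)) := by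
  have hd : ContDiff ℝ (⊤ : ℕ∞) (deriv h) := (contDiff_infty_iff_deriv.1 hs).2
  have hq : ContDiff ℝ (⊤ : ℕ∞) (fun y => (deriv h y)⁻¹) := hd.inv fun y => (hp y).ne'
  have hmono : StrictMono h := strictMono_of_deriv_pos hp
  let e : ℝ ≃ₜ ℝ := (hmono.orderIsoOfSurjective h hsurj).toHomeomorph
  have he : ∀ y, e y = h y := fun y => rfl
  have hes : ContDiff ℝ (⊤ : ℕ∞) (e.symm : ℝ → ℝ) :=
    e.contDiff_symm_deriv (f' := deriv h) (fun y => (hp y).ne')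
      (fun y => ((hs.differentiable (by simp)) y).hasDerivAt) hs
  set ψ : R4 → R4 := fun p => (p.1, p.2.1 * (deriv h p.2.2.2)⁻¹, p.2.2.1, h p.2.2.2) with hψ
  let φ : R4 → R4 := fun p => (p.1, p.2.1 * deriv h (e.symm p.2.2.2), p.2.2.1, e.symm p.2.2.2)
  have hl : Function.LeftInverse φ ψ := by
    rintro ⟨x, y, z, t⟩
    have : e.symm (h t) = t := e.symm_apply_apply t
    simp [φ, hψ, this, (hp t).ne']
  have hr : Function.RightInverse φ ψ := by
    rintro ⟨x, y, z, t⟩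
    have : h (e.symm t) = t := e.apply_symm_apply t
    simp [φ, hψ, this, (hp (e.symm t)).ne']
  refine ⟨⟨hl.injective, hr.surjective⟩, ?_, ?_, ?_⟩
  · have hq4 : ContDiff ℝ (⊤ : ℕ∞) (fun p : R4 => (deriv h p.2.2.2)⁻¹) :=
      hq.comp (contDiff_snd.comp (contDiff_snd.comp contDiff_snd))
    have h4 : ContDiff ℝ (⊤ : ℕ∞) (fun p : R4 => h p.2.2.2) := by fun_prop
    exact contDiff_fst.prodMk (((contDiff_fst.comp contDiff_snd).mul hq4).prodMk
      ((contDiff_fst.comp (contDiff_snd.comp contDiff_snd)).prodMk h4))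
  · have : Function.invFun ψ = φ := by
      funext p
      apply hl.injective
      rw [hr p]
      exact Function.rightInverse_invFun hr.surjective p
    rw [this]
    fun_prop
  · intro p u v
    have c1 : HasFDerivAt (fun p : R4 => p.1) (ContinuousLinearMap.fst ℝ ℝ (ℝ × ℝ × ℝ)) p :=
      hasFDerivAt_fst
    have c234 : HasFDerivAt (fun p : R4 => p.2) (ContinuousLinearMap.snd ℝ ℝ (ℝ × ℝ × ℝ)) p :=
      hasFDerivAt_snd
    have c2 := c234.fst
    have c3 := c234.snd.fst
    have c4 := c234.snd.snd
    have dh := ((hs.differentiable (by simp)) p.2.2.2).hasDerivAt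
    have dq := ((hq.differentiable (by simp)) p.2.2.2).hasDerivAt
    have H := c1.prodMk ((c2.mul (dq.comp_hasFDerivAt p c4)).prodMk
      (c3.prodMk (dh.comp_hasFDerivAt p c4)))
    have H' : fderiv ℝ ψ p = _ := H.fderiv
    rw [H']
    have := (hp p.2.2.2).ne'
    simp [omega4]
    field_simp
    ring

/-- Moving two levels by a symplectomorphism. -/
theorem two_level_shift (a b c d : ℝ) (hab : a < b) (hb0 : b < 0) (hcd : c < d) (hd0 : d < 0) :
    ∃ (ψ : R4 → R4) (δ : ℝ), 0 < δ ∧ IsSymplectomorphism ψ ∧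
      (∀ p : R4, 0 ≤ p.2.2.2 → ψ p = p) ∧
      (∀ p : R4, |p.2.2.2 - b| < δ → ψ p = (p.1, p.2.1, p.2.2.1, p.2.2.2 + (d - b))) ∧
      (∀ p : R4, p.2.2.2 < a + δ → ψ p = (p.1, p.2.1, p.2.2.1, p.2.2.2 + (c - a))) := by
  obtain ⟨h1, δ1, hδ1, s1, p1, t1, b1⟩ := aux_shift b 0 (-d) hb0 (by linarith)
  obtain ⟨h2, δ2, hδ2, s2, p2, t2, b2⟩ := aux_shift (a + (d - b)) d (d - c) (by linarith)
    (by linarith)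
  obtain ⟨δ, hδ, e1, e2, e3, e4⟩ :
      ∃ δ : ℝ, 0 < δ ∧ δ ≤ δ1 ∧ δ ≤ δ2 ∧ δ ≤ b - a ∧ δ ≤ -d :=
    ⟨min (min δ1 (-d)) (min δ2 (b - a)),
      lt_min (lt_min hδ1 (neg_pos.2 hd0)) (lt_min hδ2 (sub_pos.2 hab)),
      (min_le_left _ _).trans (min_le_left _ _),
      (min_le_right _ _).trans (min_le_left _ _), (min_le_right _ _).trans (min_le_right _ _),
      (min_le_left _ _).trans (min_le_right _ _)⟩
  have hder : ∀ y, HasDerivAt (h2 ∘ h1) (deriv h2 (h1 y) * deriv h1 y) y := fun y =>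
    ((s2.differentiable (by simp)) (h1 y)).hasDerivAt.comp y
      ((s1.differentiable (by simp)) y).hasDerivAt
  have hs : ContDiff ℝ (⊤ : ℕ∞) (h2 ∘ h1) := s2.comp s1
  have hp : ∀ y, 0 < deriv (h2 ∘ h1) y := by
    intro y; rw [(hder y).deriv]; exact mul_pos (p2 _) (p1 _)
  have ht : ∀ y ∈ Set.Ioi (-δ), (h2 ∘ h1) y = y + 0 := by
    intro y hy
    have hy : -δ < y := hy
    have : h1 y = y := t1 y (by linarith)
    show h2 (h1 y) = y + 0
    rw [this, t2 y (by linarith), add_zero]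
  have hm : ∀ y ∈ Set.Ioo (b - δ) (b + δ), (h2 ∘ h1) y = y + (d - b) := by
    rintro y ⟨hy, hy'⟩
    have : h1 y = y + (0 - b - -d) := b1 y (by linarith)
    show h2 (h1 y) = _
    rw [this, t2 _ (by linarith)]; ring
  have hb : ∀ y ∈ Set.Iio (a + δ), (h2 ∘ h1) y = y + (c - a) := by
    intro y hy
    have hy : y < a + δ := hy
    have : h1 y = y + (0 - b - -d) := b1 y (by linarith)
    show h2 (h1 y) = _
    rw [this, b2 _ (by linarith)]; ring
  have hone : ∀ (U : Set ℝ) (s : ℝ), IsOpen U → (∀ y ∈ U, (h2 ∘ h1) y = y + s) →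
      ∀ y ∈ U, deriv (h2 ∘ h1) y = 1 := by
    intro U s hU h y hy
    have : (h2 ∘ h1) =ᶠ[nhds y] fun y => y + s :=
      Filter.eventuallyEq_of_mem (hU.mem_nhds hy) h
    rw [this.deriv_eq]
    simp
  have hsurj : Function.Surjective (h2 ∘ h1) := by
    intro z
    apply mem_range_of_exists_le_of_exists_ge hs.continuous
    · refine ⟨min a (z - (c - a)), ?_⟩
      rw [hb _ (lt_of_le_of_lt (min_le_left a (z - (c - a))) (lt_add_of_pos_right a hδ))]
      have := min_le_right a (z - (c - a))
      linarith
    · refine ⟨max 0 z, ?_⟩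
      rw [ht _ (lt_of_lt_of_le (neg_lt_zero.2 hδ) (le_max_left 0 z)), add_zero]
      exact le_max_right _ _
  refine ⟨_, δ, hδ, aux_symp (h2 ∘ h1) hs hp hsurj, ?_, ?_, ?_⟩
  · rintro ⟨x, y, z, t⟩ h
    have hmem : t ∈ Set.Ioi (-δ) := lt_of_lt_of_le (neg_lt_zero.2 hδ) h
    show (x, y * (deriv (h2 ∘ h1) t)⁻¹, z, (h2 ∘ h1) t) = _
    rw [hone _ _ isOpen_Ioi ht t hmem, ht t hmem, inv_one, mul_one, add_zero]
  · rintro ⟨x, y, z, t⟩ h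
    have h' := abs_lt.1 h
    have hmem : t ∈ Set.Ioo (b - δ) (b + δ) :=
      ⟨by have := h'.1; simp only at this; linarith, by have := h'.2; simp only at this; linarith⟩
    show (x, y * (deriv (h2 ∘ h1) t)⁻¹, z, (h2 ∘ h1) t) = _
    rw [hone _ _ isOpen_Ioo hm t hmem, hm t hmem, inv_one, mul_one]
  · rintro ⟨x, y, z, t⟩ h
    have hmem : t ∈ Set.Iio (a + δ) := h
    show (x, y * (deriv (h2 ∘ h1) t)⁻¹, z, (h2 ∘ h1) t) = _
    rw [hone _ _ isOpen_Iio hb t hmem, hb t hmem, inv_one, mul_one]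
end
end

section
/- Let L be a flat-at-infinity planar Lagrangian and let a < b < 0 be such that L is transverse to {y₂ = a} and to {y₂ = b}. Then for all real numbers c < d < 0 there exists a flat-at-infinity planar Lagrangian M, transverse to {y₂ = c} and to {y₂ = d}, such that M ∩ {y₂ = c} = { p + (0, 0, 0, c − a) : p ∈ L ∩ {y₂ = a} } and M ∩ {y₂ = d} = { p + (0, 0, 0, d − b) : p ∈ L ∩ {y₂ = b} }. (Lemma: moving the levels of two slices.) -/
noncomputable section

/-- A smooth nonnegative bump, positive exactly on (u, v). -/
def wbump (u v y : ℝ) : ℝ := expNegInvGlue (y - u) * expNegInvGlue (v - y)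

lemma wbump_contDiff (u v : ℝ) : ContDiff ℝ (⊤ : ℕ∞) (wbump u v) := by
  unfold wbump
  exact (expNegInvGlue.contDiff.comp (contDiff_id.sub contDiff_const)).mul
    (expNegInvGlue.contDiff.comp (contDiff_const.sub contDiff_id))

lemma wbump_nonneg (u v y : ℝ) : 0 ≤ wbump u v y :=
  mul_nonneg (expNegInvGlue.nonneg _) (expNegInvGlue.nonneg _)

lemma wbump_pos {u v y : ℝ} (h1 : u < y) (h2 : y < v) : 0 < wbump u v y :=
  mul_pos (expNegInvGlue.pos_of_pos (by linarith)) (expNegInvGlue.pos_of_pos (by linarith))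

lemma wbump_left {u v y : ℝ} (h1 : y ≤ u) : wbump u v y = 0 := by
  simp [wbump, expNegInvGlue.zero_of_nonpos (show y - u ≤ 0 by linarith)]

lemma wbump_right {u v y : ℝ} (h1 : v ≤ y) : wbump u v y = 0 := by
  simp [wbump, expNegInvGlue.zero_of_nonpos (show v - y ≤ 0 by linarith)]

lemma exists_rate {u v s : ℝ} (huv : u < v) (hs : 0 < s) :
    ∃ l : ℝ, ∫ y in u..v, Real.exp (l * wbump u v y) = s := by
  have hwc : Continuous (wbump u v) := (wbump_contDiff u v).continuous
  set I : ℝ → ℝ := fun l => ∫ y in u..v, Real.exp (l * wbump u v y) with hI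
  have hcont : Continuous I := by
    apply intervalIntegral.continuous_parametric_intervalIntegral_of_continuous'
    unfold Function.uncurry
    fun_prop
  have htop : Filter.Tendsto I Filter.atTop Filter.atTop := by
    have hpos : 0 < ∫ y in u..v, wbump u v y :=
      intervalIntegral.intervalIntegral_pos_of_pos_on (hwc.intervalIntegrable _ _)
        (fun y hy => wbump_pos hy.1 hy.2) huv
    refine Filter.tendsto_atTop_mono (f := fun l => l * ∫ y in u..v, wbump u v y) ?_
      (Filter.tendsto_id.atTop_mul_const hpos)
    intro l
    simp only [hI]
    rw [← intervalIntegral.integral_const_mul]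
    apply intervalIntegral.integral_mono_on huv.le
    · exact (by fun_prop : Continuous _).intervalIntegrable _ _
    · exact (by fun_prop : Continuous _).intervalIntegrable _ _
    · intro y _
      linarith [Real.add_one_le_exp (l * wbump u v y)]
  have hbot : Filter.Tendsto I Filter.atBot (nhds 0) := by
    have : Filter.Tendsto I Filter.atBot (nhds (∫ y in u..v, (0 : ℝ))) := by
      apply intervalIntegral.tendsto_integral_filter_of_dominated_convergence (fun _ => (1 : ℝ))
      · refine Filter.Eventually.of_forall fun l => ?_
        exact (by fun_prop : Continuous _).aestronglyMeasurable
      · filter_upwards [Filter.eventually_le_atBot (0 : ℝ)] with l hl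
        refine Filter.Eventually.of_forall fun y _ => ?_
        rw [Real.norm_eq_abs, abs_of_pos (Real.exp_pos _)]
        exact Real.exp_le_one_iff.2 (mul_nonpos_of_nonpos_of_nonneg hl (wbump_nonneg _ _ _))
      · exact intervalIntegrable_const
      · have : ∀ᵐ y : ℝ, y ≠ v := by
          simp [MeasureTheory.ae_iff]
        filter_upwards [this] with y hy hy2
        rw [Set.uIoc_of_le huv.le] at hy2
        have hw := wbump_pos hy2.1 (lt_of_le_of_ne hy2.2 hy)
        exact Real.tendsto_exp_atBot.comp (Filter.tendsto_id.atBot_mul_const hw)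
    simpa using this
  obtain ⟨l1, h1⟩ := (hbot.eventually (gt_mem_nhds hs)).exists
  obtain ⟨l2, h2⟩ := (htop.eventually (Filter.eventually_ge_atTop s)).exists
  exact mem_range_of_exists_le_of_exists_ge hcont ⟨l1, h1.le⟩ ⟨l2, h2⟩

lemma exists_reparam {a b c d : ℝ} (hab : a < b) (hb0 : b < 0) (hcd : c < d) (hd0 : d < 0) :
    ∃ h g G : ℝ → ℝ, ContDiff ℝ (⊤ : ℕ∞) h ∧ ContDiff ℝ (⊤ : ℕ∞) G ∧
      (∀ y, HasDerivAt h (g y) y) ∧ (∀ y, g y * G y = 1) ∧ Function.Injective h ∧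
      h a = c ∧ h b = d ∧ h 0 = 0 ∧ G a = 1 ∧ G b = 1 ∧ G 0 = 1 := by
  obtain ⟨l, hl⟩ := exists_rate hab (show 0 < d - c by linarith)
  obtain ⟨m, hm⟩ := exists_rate hb0 (show 0 < -d by linarith)
  set e : ℝ → ℝ := fun y => l * wbump a b y + m * wbump b 0 y with he
  have hes : ContDiff ℝ (⊤ : ℕ∞) e :=
    (contDiff_const.mul (wbump_contDiff a b)).add (contDiff_const.mul (wbump_contDiff b 0))
  have hgs : ContDiff ℝ (⊤ : ℕ∞) (fun y => Real.exp (e y)) := hes.exp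
  have hderiv : ∀ y, HasDerivAt (fun y => d + ∫ t in b..y, Real.exp (e t)) (Real.exp (e y)) y := by
    intro y
    exact (intervalIntegral.integral_hasDerivAt_right (hgs.continuous.intervalIntegrable _ _)
      (hgs.continuous.stronglyMeasurableAtFilter _ _) hgs.continuous.continuousAt).const_add d
  refine ⟨fun y => d + ∫ t in b..y, Real.exp (e t), fun y => Real.exp (e y),
    fun y => Real.exp (-e y), ?_, hes.neg.exp, hderiv, ?_, ?_, ?_, ?_, ?_, ?_, ?_, ?_⟩
  · rw [contDiff_infty_iff_deriv]
    refine ⟨fun y => (hderiv y).differentiableAt, ?_⟩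
    rw [show deriv (fun y => d + ∫ t in b..y, Real.exp (e t)) = fun y => Real.exp (e y) from
      funext fun y => (hderiv y).deriv]
    exact hgs
  · intro y
    rw [← Real.exp_add]; simp
  · apply StrictMono.injective
    apply strictMono_of_deriv_pos
    intro y
    rw [(hderiv y).deriv]
    exact Real.exp_pos _
  · have : ∫ t in a..b, Real.exp (e t) = d - c := by
      rw [← hl]
      apply intervalIntegral.integral_congr
      intro y hy
      rw [Set.uIcc_of_le hab.le] at hy
      simp [he, wbump_left hy.2]
    simp only
    rw [intervalIntegral.integral_symm, this]; ring
  · simp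
  · have : ∫ t in b..0, Real.exp (e t) = -d := by
      rw [← hm]
      apply intervalIntegral.integral_congr
      intro y hy
      rw [Set.uIcc_of_le hb0.le] at hy
      simp [he, wbump_right hy.1]
    simp only
    rw [this]; ring
  · simp [he, wbump_left le_rfl, wbump_left hab.le]
  · simp [he, wbump_left le_rfl, wbump_right le_rfl]
  · simp [he, wbump_right le_rfl, wbump_right hb0.le]

/-- The symplectic lift of a reparametrization of the y₂ axis. -/
def liftY2 (h G : ℝ → ℝ) (q : R4) : R4 := (q.1, q.2.1 * G q.2.2.2, q.2.2.1, h q.2.2.2)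

lemma fderiv_lift {h g G : ℝ → ℝ} (hG : ContDiff ℝ (⊤ : ℕ∞) G)
    (hd : ∀ y, HasDerivAt h (g y) y) {f : R2 → R4} (hf : ContDiff ℝ (⊤ : ℕ∞) f) (p u : R2) :
    fderiv ℝ (liftY2 h G ∘ f) p u =
      ((fderiv ℝ f p u).1,
       (f p).2.1 * (deriv G (f p).2.2.2 * (fderiv ℝ f p u).2.2.2) +
         G (f p).2.2.2 * (fderiv ℝ f p u).2.1,
       (fderiv ℝ f p u).2.2.1, g (f p).2.2.2 * (fderiv ℝ f p u).2.2.2) := by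
  have hf' : HasFDerivAt f (fderiv ℝ f p) p :=
    (hf.differentiable (by simp)).differentiableAt.hasFDerivAt
  have h1 := hf'.fst
  have h2 := hf'.snd.fst
  have h3 := hf'.snd.snd.fst
  have h4 := hf'.snd.snd.snd
  have hGd : HasDerivAt G (deriv G (f p).2.2.2) (f p).2.2.2 :=
    (hG.differentiable (by simp)).differentiableAt.hasDerivAt
  have h5 := hGd.comp_hasFDerivAt p h4
  have h6 := (hd (f p).2.2.2).comp_hasFDerivAt p h4
  have := h1.prodMk ((h2.mul h5).prodMk (h3.prodMk h6))
  have h7 : fderiv ℝ (liftY2 h G ∘ f) p = _ := HasFDerivAt.fderiv this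
  rw [h7]
  simp

lemma flat_lift {h g G : ℝ → ℝ} (hh : ContDiff ℝ (⊤ : ℕ∞) h) (hG : ContDiff ℝ (⊤ : ℕ∞) G)
    (hd : ∀ y, HasDerivAt h (g y) y) (hgG : ∀ y, g y * G y = 1) (hinj : Function.Injective h)
    (h0 : h 0 = 0) (hG0 : G 0 = 1) {f : R2 → R4} (hf : IsFlatParam f) :
    IsFlatParam (liftY2 h G ∘ f) := by
  obtain ⟨hs, hi, -, hdi, hom, K, hK, hfl⟩ := hf
  have hG' : ∀ y, G y ≠ 0 := fun y hy => by simpa [hy] using hgG y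
  have hg' : ∀ y, g y ≠ 0 := fun y hy => by simpa [hy] using hgG y
  have hsm : ContDiff ℝ (⊤ : ℕ∞) (liftY2 h G ∘ f) := by
    have : ContDiff ℝ (⊤ : ℕ∞) (liftY2 h G) := by
      unfold liftY2
      fun_prop
    exact this.comp hs
  have hflat : ∀ p : R2, p ∉ K → (liftY2 h G ∘ f) p = (p.1, p.2, 0, 0) := by
    intro p hp
    simp [liftY2, hfl p hp, h0, hG0]
  refine ⟨hsm, ?_, ?_, ?_, ?_, K, hK, hflat⟩
  · refine Function.Injective.comp ?_ hi
    rintro ⟨x1, x2, y1, y2⟩ ⟨x1', x2', y1', y2'⟩ hq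
    simp only [liftY2, Prod.mk.injEq] at hq
    obtain ⟨e1, e2, e3, e4⟩ := hq
    have e4 := hinj e4
    subst e4
    have e2 := mul_right_cancel₀ (hG' _) e2
    simp [e1, e2, e3]
  · rw [isProperMap_iff_isCompact_preimage]
    refine ⟨hsm.continuous, fun C hC => ?_⟩
    have hc : IsCompact (K ∪ (fun q : R4 => ((q.1, q.2.1) : R2)) '' C) :=
      hK.union (hC.image (by fun_prop))
    refine hc.of_isClosed_subset (hC.isClosed.preimage hsm.continuous) ?_
    intro p hp
    by_cases hpK : p ∈ K
    · exact Or.inl hpK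
    · refine Or.inr ⟨_, hp, ?_⟩
      rw [hflat p hpK]
  · intro p u v huv
    apply hdi p
    rw [fderiv_lift hG hd hs, fderiv_lift hG hd hs] at huv
    simp only [Prod.mk.injEq] at huv
    obtain ⟨e1, e2, e3, e4⟩ := huv
    have e4 := mul_left_cancel₀ (hg' _) e4
    rw [e4] at e2
    have e2 := mul_left_cancel₀ (hG' _) (add_left_cancel e2)
    exact Prod.ext e1 (Prod.ext e2 (Prod.ext e3 e4))
  · intro p u v
    rw [fderiv_lift hG hd hs, fderiv_lift hG hd hs]
    have h1 := hom p u v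
    have h2 := hgG (f p).2.2.2
    simp only [omega4] at h1 ⊢
    linear_combination h1 + ((fderiv ℝ f p u).2.1 * (fderiv ℝ f p v).2.2.2 -
      (fderiv ℝ f p u).2.2.2 * (fderiv ℝ f p v).2.1) * h2

lemma transverse_lift {h g G : ℝ → ℝ} (hh : ContDiff ℝ (⊤ : ℕ∞) h) (hG : ContDiff ℝ (⊤ : ℕ∞) G)
    (hd : ∀ y, HasDerivAt h (g y) y) (hgG : ∀ y, g y * G y = 1) (hinj : Function.Injective h)
    (h0 : h 0 = 0) (hG0 : G 0 = 1) {L : Set R4} {a c : ℝ} (hac : h a = c)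
    (hL : TransverseAt L a) : TransverseAt (liftY2 h G '' L) c := by
  obtain ⟨f, hf, rfl, ht⟩ := hL
  refine ⟨liftY2 h G ∘ f, flat_lift hh hG hd hgG hinj h0 hG0 hf, Set.range_comp _ _, ?_⟩
  intro p hp hz
  have hpa : (f p).2.2.2 = a := hinj (by rw [hac, ← hp]; rfl)
  apply ht p hpa
  have hfd : HasFDerivAt f (fderiv ℝ f p) p :=
    (hf.1.differentiable (by simp)).differentiableAt.hasFDerivAt
  have h4 : HasFDerivAt (fun q => (f q).2.2.2) (fderiv ℝ (fun q => (f q).2.2.2) p) p :=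
    hfd.snd.snd.snd.differentiableAt.hasFDerivAt
  have h6 := (hd (f p).2.2.2).comp_hasFDerivAt p h4
  have h7 : fderiv ℝ (fun q => ((liftY2 h G ∘ f) q).2.2.2) p = _ := HasFDerivAt.fderiv h6
  rw [h7] at hz
  exact (smul_eq_zero.1 hz).resolve_left fun hy => by simpa [hy] using hgG (f p).2.2.2

lemma slice_lift {h G : ℝ → ℝ} (hinj : Function.Injective h) {L : Set R4} {a c : ℝ}
    (hac : h a = c) (hGa : G a = 1) :
    liftY2 h G '' L ∩ {p : R4 | p.2.2.2 = c} =
      (fun p : R4 => (p.1, p.2.1, p.2.2.1, p.2.2.2 + (c - a))) ''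
        (L ∩ {p : R4 | p.2.2.2 = a}) := by
  have key : ∀ q : R4, q.2.2.2 = a →
      liftY2 h G q = (q.1, q.2.1, q.2.2.1, q.2.2.2 + (c - a)) := by
    intro q hq
    simp [liftY2, hq, hac, hGa]
  ext p
  constructor
  · rintro ⟨⟨q, hq, rfl⟩, hp⟩
    have hqa : q.2.2.2 = a := hinj (by rw [hac, ← show _ = c from hp]; rfl)
    exact ⟨q, ⟨hq, hqa⟩, (key q hqa).symm⟩
  · rintro ⟨q, ⟨hq, hqa⟩, rfl⟩
    refine ⟨⟨q, hq, key q hqa⟩, ?_⟩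
    have : q.2.2.2 = a := hqa
    simp [this]

/-- Moving the levels of two slices. -/
theorem move_levels (L : Set R4) (a b : ℝ) (hab : a < b) (hb0 : b < 0)
    (hL : IsFlatLagrangian L) (hLa : TransverseAt L a) (hLb : TransverseAt L b)
    (c d : ℝ) (hcd : c < d) (hd0 : d < 0) :
    ∃ M : Set R4, IsFlatLagrangian M ∧ TransverseAt M c ∧ TransverseAt M d ∧
      M ∩ {p : R4 | p.2.2.2 = c} =
        (fun p : R4 => (p.1, p.2.1, p.2.2.1, p.2.2.2 + (c - a))) '' (L ∩ {p : R4 | p.2.2.2 = a}) ∧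
      M ∩ {p : R4 | p.2.2.2 = d} =
        (fun p : R4 => (p.1, p.2.1, p.2.2.1, p.2.2.2 + (d - b))) '' (L ∩ {p : R4 | p.2.2.2 = b}) := by
  obtain ⟨h, g, G, hh, hG, hd, hgG, hinj, ha, hb, h0, hGa, hGb, hG0⟩ :=
    exists_reparam hab hb0 hcd hd0
  refine ⟨liftY2 h G '' L, ?_, transverse_lift hh hG hd hgG hinj h0 hG0 ha hLa,
    transverse_lift hh hG hd hgG hinj h0 hG0 hb hLb, slice_lift hinj ha hGa,
    slice_lift hinj hb hGb⟩
  obtain ⟨f, hf, rfl⟩ := hL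
  exact ⟨liftY2 h G ∘ f, flat_lift hh hG hd hgG hinj h0 hG0 hf, Set.range_comp _ _⟩
end
end

section
/- For every ε > 0 there exists a bijection τ from the open half-plane Hₑ = {(x, y) ∈ ℝ² : x < 0} onto ℝ² such that τ is infinitely differentiable, its inverse is infinitely differentiable, det Dτ(p) = 1 for every p ∈ Hₑ, and τ(x, y) = (x, y) whenever x ≤ −ε. -/
noncomputable section

lemma aux_f (ε : ℝ) (hε : 0 < ε) : ∃ f : ℝ → ℝ,
    ContDiffOn ℝ (⊤ : ℕ∞) f (Set.Iio 0) ∧ (∀ x < 0, 0 < deriv f x) ∧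
    (∀ y, ∃ x < 0, f x = y) ∧ (∀ x ≤ -ε, f x = x ∧ deriv f x = 1) := by
  have hd : Differentiable ℝ expNegInvGlue :=
    (expNegInvGlue.contDiff (n := 1)).differentiable (by simp)
  have hder : ∀ x < 0, HasDerivAt (fun x : ℝ => x + expNegInvGlue (x + ε) * (-x⁻¹))
      (1 + (deriv expNegInvGlue (x + ε) * (-x⁻¹) + expNegInvGlue (x + ε) * (x ^ 2)⁻¹)) x := by
    intro x hx
    have h1 : HasDerivAt (fun x => expNegInvGlue (x + ε)) (deriv expNegInvGlue (x + ε)) x :=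
      (hd (x + ε)).hasDerivAt.comp_add_const x ε
    have h2 : HasDerivAt (fun x : ℝ => -x⁻¹) ((x ^ 2)⁻¹) x := by
      simpa using (hasDerivAt_inv hx.ne).fun_neg
    exact (hasDerivAt_id x).fun_add (h1.fun_mul h2)
  have hfid : ∀ x ≤ -ε, x + expNegInvGlue (x + ε) * (-x⁻¹) = x := by
    intro x hx
    rw [expNegInvGlue.zero_of_nonpos (by linarith)]; simp
  have hcd : ContDiffOn ℝ (⊤ : ℕ∞) (fun x : ℝ => x + expNegInvGlue (x + ε) * (-x⁻¹))
      (Set.Iio 0) := by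
    refine contDiffOn_id.add (ContDiffOn.mul ?_ (ContDiffOn.neg ?_))
    · exact (expNegInvGlue.contDiff.comp (contDiff_id.add contDiff_const)).contDiffOn
    · exact contDiffOn_id.inv (fun x hx => ne_of_lt hx)
  refine ⟨fun x => x + expNegInvGlue (x + ε) * (-x⁻¹), hcd, ?_, ?_, ?_⟩
  · intro x hx
    rw [(hder x hx).deriv]
    have h1 : 0 ≤ deriv expNegInvGlue (x + ε) := by
      rw [← derivWithin_univ]
      exact (expNegInvGlue.monotone.monotoneOn _).derivWithin_nonneg
    have h2 : 0 ≤ -x⁻¹ := by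
      have := inv_neg''.2 hx
      linarith
    have h3 := expNegInvGlue.nonneg (x + ε)
    positivity
  · intro y
    set c := expNegInvGlue (ε / 2) with hc
    have hcpos : 0 < c := expNegInvGlue.pos_of_pos (by linarith)
    set b := min (ε / 2) (c / (|y| + ε)) with hb
    have hy := abs_nonneg y
    have hbpos : 0 < b := lt_min (by linarith) (by positivity)
    have hb1 : b ≤ ε / 2 := min_le_left _ _
    have hb2 : b ≤ c / (|y| + ε) := min_le_right _ _
    have hlow : min (-ε) y + expNegInvGlue (min (-ε) y + ε) * (-(min (-ε) y)⁻¹) ≤ y := by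
      rw [hfid _ (min_le_left _ _)]; exact min_le_right _ _
    have hhigh : y ≤ -b + expNegInvGlue (-b + ε) * (-(-b)⁻¹) := by
      have h1 : c ≤ expNegInvGlue (-b + ε) := expNegInvGlue.monotone (by linarith)
      have h2 : |y| + ε ≤ c * b⁻¹ := by
        rw [← div_eq_mul_inv, le_div_iff₀ hbpos]
        rwa [le_div_iff₀ (by positivity), mul_comm] at hb2
      have h3 : c * b⁻¹ ≤ expNegInvGlue (-b + ε) * b⁻¹ := by gcongr
      have h4 := le_abs_self y
      rw [inv_neg, neg_neg]; linarith
    have ha : min (-ε) y < 0 := lt_of_le_of_lt (min_le_left _ _) (by linarith)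
    obtain ⟨x, hx, hxy⟩ := isPreconnected_Iio.intermediate_value (s := Set.Iio (0 : ℝ))
      (Set.mem_Iio.2 ha) (Set.mem_Iio.2 (neg_lt_zero.2 hbpos)) hcd.continuousOn ⟨hlow, hhigh⟩
    exact ⟨x, hx, hxy⟩
  · intro x hx
    refine ⟨hfid x hx, ?_⟩
    rw [(hder x (by linarith)).deriv, expNegInvGlue.zero_of_nonpos (by linarith)]
    have : deriv expNegInvGlue (x + ε) = 0 := by
      apply IsLocalMin.deriv_eq_zero
      refine Filter.Eventually.of_forall fun z => ?_
      rw [expNegInvGlue.zero_of_nonpos (by linarith : x + ε ≤ 0)]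
      exact expNegInvGlue.nonneg z
    rw [this]; simp

lemma aux_g (f : ℝ → ℝ) (hf : ContDiffOn ℝ (⊤ : ℕ∞) f (Set.Iio 0))
    (hpos : ∀ x < 0, 0 < deriv f x) (hs : ∀ y, ∃ x < 0, f x = y) :
    ∃ g : ℝ → ℝ, ContDiff ℝ (⊤ : ℕ∞) g ∧ (∀ y, g y < 0 ∧ f (g y) = y) ∧
      ∀ x < 0, g (f x) = x := by
  have hmono : StrictMonoOn f (Set.Iio 0) :=
    strictMonoOn_of_deriv_pos (convex_Iio 0) hf.continuousOn (by simpa using hpos)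
  choose g hg0 hfg using hs
  have hgf : ∀ x < 0, g (f x) = x := fun x hx => hmono.injOn (hg0 _) hx (hfg _)
  refine ⟨g, ?_, fun y => ⟨hg0 y, hfg y⟩, hgf⟩
  rw [contDiff_iff_contDiffAt]
  intro y
  have hca : ContDiffAt ℝ (⊤ : ℕ∞) f (g y) := hf.contDiffAt (Iio_mem_nhds (hg0 y))
  have hn : ((⊤ : ℕ∞) : WithTop ℕ∞) ≠ 0 := by simp
  have hda : HasDerivAt f (deriv f (g y)) (g y) := (hca.differentiableAt hn).hasDerivAt
  have hne := (hpos _ (hg0 y)).ne'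
  have hfd : HasFDerivAt f
      ((ContinuousLinearEquiv.unitsEquivAut ℝ (Units.mk0 _ hne) : ℝ ≃L[ℝ] ℝ) : ℝ →L[ℝ] ℝ) (g y) :=
    hda.hasFDerivAt_equiv hne
  have hst := hca.hasStrictFDerivAt' hfd hn
  have h1 := hca.to_localInverse hfd hn
  have h2 := hst.eventually_right_inverse
  have h3 := hst.localInverse_tendsto.eventually (Iio_mem_nhds (hg0 y))
  rw [hfg y] at h1 h2 h3
  refine h1.congr_of_eventuallyEq ?_
  filter_upwards [h2, h3] with z hz2 hz3
  exact hmono.injOn (hg0 _) hz3 (by rw [hfg]; exact hz2.symm)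

/-- An area-preserving diffeomorphism from the open half-plane onto ℝ²,
    equal to the identity on {x ≤ −ε}. -/
theorem halfplane_diffeo (ε : ℝ) (hε : 0 < ε) :
    ∃ τ τinv : R2 → R2,
      ContDiffOn ℝ (⊤ : ℕ∞) τ {p : R2 | p.1 < 0} ∧
      ContDiff ℝ (⊤ : ℕ∞) τinv ∧
      (∀ p : R2, p.1 < 0 → τinv (τ p) = p) ∧
      (∀ q : R2, (τinv q).1 < 0 ∧ τ (τinv q) = q) ∧
      (∀ p : R2, p.1 < 0 → LinearMap.det ((fderiv ℝ τ p) : R2 →ₗ[ℝ] R2) = 1) ∧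
      (∀ p : R2, p.1 ≤ -ε → τ p = p) := by
  obtain ⟨f, hf, hpos, hs, hid⟩ := aux_f ε hε
  obtain ⟨g, hg, hg1, hgf⟩ := aux_g f hf hpos hs
  have hdf : ContDiffOn ℝ (⊤ : ℕ∞) (deriv f) (Set.Iio 0) :=
    hf.deriv_of_isOpen isOpen_Iio (by simp)
  have hmaps : Set.MapsTo (Prod.fst : R2 → ℝ) {p : R2 | p.1 < 0} (Set.Iio 0) := fun p hp => hp
  have hk : ContDiffOn ℝ (⊤ : ℕ∞) (fun x => (deriv f x)⁻¹) (Set.Iio 0) :=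
    hdf.inv fun x hx => (hpos x hx).ne'
  refine ⟨fun p => (f p.1, p.2 * (deriv f p.1)⁻¹), fun q => (g q.1, q.2 * deriv f (g q.1)),
    ?_, ?_, ?_, ?_, ?_, ?_⟩
  · exact (hf.comp contDiff_fst.contDiffOn hmaps).prodMk
      (contDiff_snd.contDiffOn.mul (hk.comp contDiff_fst.contDiffOn hmaps))
  · refine (hg.comp contDiff_fst).prodMk (contDiff_snd.mul ?_)
    rw [← contDiffOn_univ]
    exact hdf.comp (hg.comp contDiff_fst).contDiffOn (fun q _ => (hg1 q.1).1)
  · intro p hp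
    have := (hpos _ hp).ne'
    ext
    · simp [hgf _ hp]
    · simp only [hgf _ hp]; field_simp
  · intro q
    have := (hpos _ (hg1 q.1).1).ne'
    refine ⟨(hg1 q.1).1, ?_⟩
    ext
    · simp [(hg1 q.1).2]
    · simp only; field_simp
  · intro p hp
    have hne := (hpos _ hp).ne'
    have hn : ((⊤ : ℕ∞) : WithTop ℕ∞) ≠ 0 := by simp
    have h1 : HasDerivAt f (deriv f p.1) p.1 :=
      ((hf.contDiffAt (Iio_mem_nhds hp)).differentiableAt hn).hasDerivAt
    have h2 : HasDerivAt (fun x => (deriv f x)⁻¹) (deriv (fun x => (deriv f x)⁻¹) p.1) p.1 :=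
      ((hk.contDiffAt (Iio_mem_nhds hp)).differentiableAt hn).hasDerivAt
    have h1' := h1.comp_hasFDerivAt p (hasFDerivAt_fst (𝕜 := ℝ) (E := ℝ) (F := ℝ) (p := p))
    have h2' := h2.comp_hasFDerivAt p (hasFDerivAt_fst (𝕜 := ℝ) (E := ℝ) (F := ℝ) (p := p))
    have h3 := h1'.prodMk ((hasFDerivAt_snd (𝕜 := ℝ) (E := ℝ) (F := ℝ) (p := p)).mul h2')
    have h4 : fderiv ℝ (fun p : R2 => (f p.1, p.2 * (deriv f p.1)⁻¹)) p = _ := h3.fderiv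
    rw [h4, ← LinearMap.det_toMatrix (Module.Basis.finTwoProd ℝ), Matrix.det_fin_two]
    simp [LinearMap.toMatrix_apply, hne]
  · intro p hp
    simp [(hid _ hp).1, (hid _ hp).2]
end
end

section
/- Let ε > 0 and let S, S̄ be subsets of {(x, y) ∈ ℝ² : x < −ε}. Suppose φ is a compactly supported area-preserving diffeomorphism of ℝ² with φ(S) = S̄. Then there exist a compact set Q ⊆ {(x, y) ∈ ℝ² : x < 0} and an area-preserving diffeomorphism φ̃ of ℝ² such that φ̃ equals the identity outside Q and φ̃(S) = S̄. -/
noncomputable section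

theorem aux_1d (ε : ℝ) (hε : 0 < ε) : ∃ g f : ℝ → ℝ, (∀ x, g x < 0) ∧ (∀ x, f (g x) = x) ∧
    (∀ u, u < 0 → g (f u) = u) ∧ (∀ x, x ≤ -ε → g x = x) ∧ ContDiff ℝ (⊤ : ℕ∞) g ∧
    (∀ u, u < 0 → ContDiffAt ℝ (⊤ : ℕ∞) f u) ∧ ∀ x, deriv g x ≠ 0 := by
  set f : ℝ → ℝ := fun u => u + expNegInvGlue (u + ε) * (-u)⁻¹ with hf
  have hE : ContDiff ℝ (⊤ : ℕ∞) expNegInvGlue := expNegInvGlue.contDiff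
  have hfc : ∀ u, u < 0 → ContDiffAt ℝ (⊤ : ℕ∞) f u := by
    intro u hu
    have h1 : ContDiffAt ℝ (⊤ : ℕ∞) (fun u : ℝ => (-u)⁻¹) u :=
      contDiffAt_id.neg.inv (by simpa using hu.ne)
    have h2 : ContDiffAt ℝ (⊤ : ℕ∞) (fun u : ℝ => expNegInvGlue (u + ε)) u :=
      (hE.comp (contDiff_id.add contDiff_const)).contDiffAt
    exact contDiffAt_id.add (h2.mul h1)
  have hfid : ∀ u, u ≤ -ε → f u = u := by
    intro u hu
    simp [hf, expNegInvGlue.zero_of_nonpos (show u + ε ≤ 0 by linarith)]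
  have hmono0 : ∀ u v, u < v → v < 0 → v - u ≤ f v - f u := by
    intro u v huv hv
    have h1 : expNegInvGlue (u + ε) ≤ expNegInvGlue (v + ε) :=
      expNegInvGlue.monotone (by linarith)
    have h2 : (-u)⁻¹ ≤ (-v)⁻¹ := inv_anti₀ (by linarith) (by linarith)
    have h3 := mul_le_mul h1 h2 (inv_nonneg.2 (by linarith)) (expNegInvGlue.nonneg (v + ε))
    simp only [hf]
    linarith
  have hmono : StrictMonoOn f (Set.Iio 0) := by
    intro u hu v hv huv
    have := hmono0 u v huv hv
    linarith
  have hsurj : ∀ x, ∃ u, u < 0 ∧ f u = x := by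
    intro x
    by_cases hx : x ≤ -ε
    · exact ⟨x, by linarith, hfid x hx⟩
    push Not at hx
    have hEp : 0 < expNegInvGlue (ε / 2) := expNegInvGlue.pos_of_pos (by linarith)
    have hd : 0 < |x| + ε := by positivity
    set b := min (ε / 2) (expNegInvGlue (ε / 2) / (|x| + ε)) with hb
    have hb0 : 0 < b := lt_min (by linarith) (by positivity)
    have hb1 : b ≤ ε / 2 := min_le_left _ _
    have hb2 : b ≤ expNegInvGlue (ε / 2) / (|x| + ε) := min_le_right _ _
    have hfb : x ≤ f (-b) := by
      have h1 : expNegInvGlue (ε / 2) ≤ expNegInvGlue (-b + ε) :=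
        expNegInvGlue.monotone (by linarith)
      have h2 : |x| + ε ≤ expNegInvGlue (-b + ε) * b⁻¹ := by
        rw [← div_eq_mul_inv, le_div_iff₀ hb0]
        rw [le_div_iff₀ hd] at hb2
        linarith
      simp only [hf, neg_neg]
      have := le_abs_self x
      linarith
    have hc : ContinuousOn f (Set.Icc (-ε) (-b)) := fun u hu =>
      (hfc u (by linarith [hu.2])).continuousAt.continuousWithinAt
    have := intermediate_value_Icc (by linarith) hc
    obtain ⟨u, hu, hux⟩ := this ⟨by rw [hfid _ le_rfl]; exact hx.le, hfb⟩
    exact ⟨u, by linarith [hu.2], hux⟩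
  choose g hg0 hfg using hsurj
  have hgf : ∀ u, u < 0 → g (f u) = u := fun u hu =>
    hmono.injOn (hg0 _) hu (hfg _)
  have hfd : ∀ u, u < 0 → deriv f u ≠ 0 := by
    intro u hu h0
    have hd : HasDerivAt f 0 u := by
      rw [← h0]; exact ((hfc u hu).differentiableAt (by simp)).hasDerivAt
    have h1 : HasDerivAt (fun v => f v - v) (0 - 1) u := hd.sub (hasDerivAt_id u)
    have hm : MonotoneOn (fun v => f v - v) (Set.Iio 0) := by
      intro a ha b hb hab
      rcases hab.eq_or_lt with rfl | h
      · exact le_rfl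
      · have := hmono0 a b h hb
        show f a - a ≤ f b - b
        linarith
    have h2 := hm.derivWithin_nonneg (x := u)
    rw [derivWithin_of_isOpen isOpen_Iio hu, h1.deriv] at h2
    norm_num at h2
  have hgc : ContDiff ℝ (⊤ : ℕ∞) g := by
    rw [contDiff_iff_contDiffAt]
    intro x
    have hu := hg0 x
    have hd : HasDerivAt f (deriv f (g x)) (g x) :=
      ((hfc _ hu).differentiableAt (by simp)).hasDerivAt
    have hF := hd.hasFDerivAt_equiv (hfd _ hu)
    have hn : ((⊤ : ℕ∞) : WithTop ℕ∞) ≠ 0 := by simp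
    have hloc := (hfc _ hu).to_localInverse hF hn
    rw [hfg] at hloc
    refine hloc.congr_of_eventuallyEq ?_
    have hs := (hfc _ hu).hasStrictFDerivAt' hF hn
    have e1 := hs.eventually_right_inverse
    have e2 := hs.localInverse_tendsto
    have e3 := e2.eventually (isOpen_Iio.mem_nhds hu)
    rw [hfg] at e1 e3
    filter_upwards [e1, e3] with y h1 h3
    have := hgf _ h3
    rw [h1] at this
    exact this
  refine ⟨g, f, hg0, hfg, hgf, ?_, hgc, hfc, ?_⟩
  · intro x hx
    have := hgf x (by linarith)
    rwa [hfid x hx] at this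
  · intro x h0
    have h1 : HasDerivAt g 0 x := by
      rw [← h0]; exact (hgc.differentiable (by simp) x).hasDerivAt
    have h2 : HasDerivAt f (deriv f (g x)) (g x) :=
      ((hfc _ (hg0 x)).differentiableAt (by simp)).hasDerivAt
    have h3 := h2.comp x h1
    have h4 : f ∘ g = id := funext hfg
    rw [h4] at h3
    have := h3.unique (hasDerivAt_id x)
    norm_num at this

theorem aux_det2 (A : R2 →ₗ[ℝ] R2) (a b c : ℝ) (h1 : A (1, 0) = (a, c)) (h2 : A (0, 1) = (0, b)) :
    LinearMap.det A = a * b := by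
  rw [← LinearMap.det_toMatrix (Module.Basis.finTwoProd ℝ), Matrix.det_fin_two]
  simp [LinearMap.toMatrix_apply, h1, h2]

theorem aux_2d (ε : ℝ) (hε : 0 < ε) : ∃ Ψ X : R2 → R2, (∀ p, (Ψ p).1 < 0) ∧ (∀ p, X (Ψ p) = p) ∧
    (∀ p : R2, p.1 < 0 → Ψ (X p) = p) ∧ (∀ p : R2, p.1 < -ε → Ψ p = p) ∧
    ContDiff ℝ (⊤ : ℕ∞) Ψ ∧
    (∀ p : R2, p.1 < 0 → ContDiffAt ℝ (⊤ : ℕ∞) X p) ∧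
    ∀ p, LinearMap.det ((fderiv ℝ Ψ p) : R2 →ₗ[ℝ] R2) = 1 := by
  obtain ⟨g, f, hg0, hfg, hgf, hgid, hgc, hfc, hgd⟩ := aux_1d ε hε
  have hg' : ContDiff ℝ (⊤ : ℕ∞) (deriv g) := by
    have : ContDiff ℝ ((⊤ : ℕ∞) + 1) g := hgc
    exact (contDiff_succ_iff_deriv.1 this).2.2
  have hΨc : ContDiff ℝ (⊤ : ℕ∞) (fun p : R2 => ((g p.1, p.2 * (deriv g p.1)⁻¹) : R2)) :=
    (hgc.comp contDiff_fst).prodMk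
      (contDiff_snd.mul ((hg'.comp contDiff_fst).inv fun p => hgd _))
  refine ⟨fun p => (g p.1, p.2 * (deriv g p.1)⁻¹), fun p => (f p.1, p.2 * deriv g (f p.1)),
    fun p => hg0 _, ?_, ?_, ?_, hΨc, ?_, ?_⟩
  · rintro ⟨x, y⟩
    simp [hfg, hgd]
  · rintro ⟨x, y⟩ h
    simp [hgf x h, hgd]
  · rintro ⟨x, y⟩ h
    have h1 : g =ᶠ[nhds x] id := by
      filter_upwards [isOpen_Iio.mem_nhds h] with z hz using hgid z (le_of_lt hz)
    simp [hgid x (le_of_lt h), h1.deriv_eq]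
  · rintro ⟨x, y⟩ h
    have h1 : ContDiffAt ℝ (⊤ : ℕ∞) (fun p : R2 => f p.1) (x, y) :=
      ContDiffAt.comp (x, y) (hfc x h) contDiffAt_fst
    exact h1.prodMk (contDiffAt_snd.mul (hg'.contDiffAt.comp (x, y) h1))
  · rintro ⟨x, y⟩
    have hD := (hΨc.differentiable (by simp) (x, y)).hasFDerivAt
    set D := fderiv ℝ (fun p : R2 => ((g p.1, p.2 * (deriv g p.1)⁻¹) : R2)) (x, y) with hDdef
    have hgx : HasDerivAt g (deriv g x) x := (hgc.differentiable (by simp) x).hasDerivAt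
    have hi : HasDerivAt (fun t => (t, y)) ((1 : ℝ), (0 : ℝ)) x :=
      (hasDerivAt_id x).prodMk (hasDerivAt_const x y)
    have hj : HasDerivAt (fun t => (x, t)) ((0 : ℝ), (1 : ℝ)) y :=
      (hasDerivAt_const y x).prodMk (hasDerivAt_id y)
    have a1 := hD.comp_hasDerivAt x hi
    have a2 := hD.comp_hasDerivAt y hj
    have b1 : (D (1, 0)).1 = deriv g x := by
      have a3 : HasDerivAt g (D (1, 0)).1 x :=
        (hasFDerivAt_fst (𝕜 := ℝ) (E := ℝ) (F := ℝ)).comp_hasDerivAt x a1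
      exact a3.unique hgx
    have b2 : D (0, 1) = (0, (deriv g x)⁻¹) := by
      have a4 : HasDerivAt (fun t : ℝ => ((g x, t * (deriv g x)⁻¹) : R2)) (D (0, 1)) y := a2
      refine a4.unique ?_
      have := (hasDerivAt_const y (g x)).prodMk ((hasDerivAt_id y).mul_const (deriv g x)⁻¹)
      simpa using this
    rw [aux_det2 (D : R2 →ₗ[ℝ] R2) (deriv g x) (deriv g x)⁻¹ (D (1, 0)).2 (by
      show D (1, 0) = _
      rw [← b1]) b2]
    exact mul_inv_cancel₀ (hgd x)

open Classical in
/-- Conjugation of F by Ψ, extended by the identity. -/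
def conjMap (Ψ X F : R2 → R2) (p : R2) : R2 := if p.1 < 0 then Ψ (F (X p)) else p

theorem conj_support {Ψ X F : R2 → R2} {K : Set R2} (hF : ∀ p, p ∉ K → F p = p)
    (hΨX : ∀ p : R2, p.1 < 0 → Ψ (X p) = p) (p : R2) (hp : p ∉ Ψ '' K) :
    conjMap Ψ X F p = p := by
  unfold conjMap
  split_ifs with h
  · rw [hF, hΨX p h]
    intro hK
    exact hp ⟨_, hK, hΨX p h⟩
  · rfl

theorem conj_comp {Ψ X F G : R2 → R2} (h0 : ∀ p, (Ψ p).1 < 0) (hXΨ : ∀ p, X (Ψ p) = p)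
    (hΨX : ∀ p : R2, p.1 < 0 → Ψ (X p) = p) (hFG : ∀ p, F (G p) = p) (p : R2) :
    conjMap Ψ X F (conjMap Ψ X G p) = p := by
  by_cases h : p.1 < 0
  · simp [conjMap, h, h0, hXΨ, hFG, hΨX p h]
  · simp [conjMap, h]

theorem conj_evEq {Ψ X F : R2 → R2} (p : R2) (h : p.1 < 0) :
    conjMap Ψ X F =ᶠ[nhds p] fun q => Ψ (F (X q)) := by
  have : {q : R2 | q.1 < 0} ∈ nhds p := (isOpen_lt continuous_fst continuous_const).mem_nhds h
  filter_upwards [this] with q hq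
  exact if_pos hq

theorem conj_evId {Ψ X F : R2 → R2} {K : Set R2} (hK : IsCompact K) (hΨ : Continuous Ψ)
    (h0 : ∀ p, (Ψ p).1 < 0) (hF : ∀ p, p ∉ K → F p = p)
    (hΨX : ∀ p : R2, p.1 < 0 → Ψ (X p) = p) (p : R2) (h : ¬ p.1 < 0) :
    conjMap Ψ X F =ᶠ[nhds p] id := by
  have hc : IsClosed (Ψ '' K) := (hK.image hΨ).isClosed
  have : (Ψ '' K)ᶜ ∈ nhds p := hc.isOpen_compl.mem_nhds (by
    rintro ⟨q, -, rfl⟩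
    exact h (h0 q))
  filter_upwards [this] with q hq
  exact conj_support hF hΨX q hq

theorem conj_smooth {Ψ X F : R2 → R2} {K : Set R2} (hK : IsCompact K)
    (hΨ : ContDiff ℝ (⊤ : ℕ∞) Ψ) (hX : ∀ p : R2, p.1 < 0 → ContDiffAt ℝ (⊤ : ℕ∞) X p)
    (h0 : ∀ p, (Ψ p).1 < 0) (hF : ∀ p, p ∉ K → F p = p) (hFc : ContDiff ℝ (⊤ : ℕ∞) F)
    (hΨX : ∀ p : R2, p.1 < 0 → Ψ (X p) = p) : ContDiff ℝ (⊤ : ℕ∞) (conjMap Ψ X F) := by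
  rw [contDiff_iff_contDiffAt]
  intro p
  by_cases h : p.1 < 0
  · refine ContDiffAt.congr_of_eventuallyEq ?_ (conj_evEq p h)
    exact (hΨ.comp hFc).contDiffAt.comp p (hX p h)
  · exact contDiffAt_id.congr_of_eventuallyEq (conj_evId hK hΨ.continuous h0 hF hΨX p h)

theorem det_comp_aux {A B : R2 → R2} {p : R2} (hA : DifferentiableAt ℝ A (B p))
    (hB : DifferentiableAt ℝ B p) :
    LinearMap.det ((fderiv ℝ (fun q => A (B q)) p) : R2 →ₗ[ℝ] R2) =
      LinearMap.det ((fderiv ℝ A (B p)) : R2 →ₗ[ℝ] R2) *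
      LinearMap.det ((fderiv ℝ B p) : R2 →ₗ[ℝ] R2) := by
  have : fderiv ℝ (fun q => A (B q)) p = (fderiv ℝ A (B p)).comp (fderiv ℝ B p) :=
    fderiv_comp p hA hB
  rw [this, ← LinearMap.det_comp]
  rfl

/-- A compactly supported area-preserving diffeomorphism carrying S to S̄ can be
    replaced by one supported in the open left half-plane. -/
theorem support_in_halfplane (ε : ℝ) (hε : 0 < ε) (S Sbar : Set R2)
    (hS : S ⊆ {p : R2 | p.1 < -ε}) (hSbar : Sbar ⊆ {p : R2 | p.1 < -ε})
    (φ : R2 → R2) (hφ : IsAreaDiffeo φ) (hφc : IsCompactSupported φ)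
    (hφS : φ '' S = Sbar) :
    ∃ (Q : Set R2) (ψ : R2 → R2), IsCompact Q ∧ Q ⊆ {p : R2 | p.1 < 0} ∧
      IsAreaDiffeo ψ ∧ (∀ p : R2, p ∉ Q → ψ p = p) ∧ ψ '' S = Sbar := by
  obtain ⟨Ψ, X, h0, hXΨ, hΨX, hid, hΨ, hX, hdet⟩ := aux_2d ε hε
  obtain ⟨hbij, hsm, hism, hdφ⟩ := hφ
  obtain ⟨K, hK, hφK⟩ := hφc
  have hl : ∀ p, Function.invFun φ (φ p) = p := Function.leftInverse_invFun hbij.1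
  have hr : ∀ p, φ (Function.invFun φ p) = p := Function.rightInverse_invFun hbij.2
  have hiK : ∀ p, p ∉ K → Function.invFun φ p = p := by
    intro p hp
    have := hl p
    rwa [hφK p hp] at this
  have hc1 := conj_comp h0 hXΨ hΨX hl
  have hc2 := conj_comp h0 hXΨ hΨX hr
  have hb : Function.Bijective (conjMap Ψ X φ) :=
    Function.bijective_iff_has_inverse.2 ⟨_, hc1, hc2⟩
  have hinv : Function.invFun (conjMap Ψ X φ) = conjMap Ψ X (Function.invFun φ) := by
    funext p
    apply hb.1
    rw [hc2 p]
    exact Function.rightInverse_invFun hb.2 p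
  refine ⟨Ψ '' K, conjMap Ψ X φ, hK.image hΨ.continuous, ?_, ⟨hb,
    conj_smooth hK hΨ hX h0 hφK hsm hΨX, ?_, ?_⟩, conj_support hφK hΨX, ?_⟩
  · rintro _ ⟨q, -, rfl⟩
    exact h0 q
  · rw [hinv]
    exact conj_smooth hK hΨ hX h0 hiK hism hΨX
  · intro p
    by_cases h : p.1 < 0
    · rw [(conj_evEq p h).fderiv_eq]
      have dΨ : Differentiable ℝ Ψ := hΨ.differentiable (by simp)
      have dφ : Differentiable ℝ φ := hsm.differentiable (by simp)
      have dX : DifferentiableAt ℝ X p := (hX p h).differentiableAt (by simp)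
      have e1 := det_comp_aux (A := Ψ) (B := fun q => φ (X q)) (p := p) (dΨ _)
        ((dφ _).comp p dX)
      have e2 := det_comp_aux (A := φ) (B := X) (p := p) (dφ _) dX
      have e3 := det_comp_aux (A := Ψ) (B := X) (p := p) (dΨ _) dX
      have e4 : (fun q => Ψ (X q)) =ᶠ[nhds p] id := by
        have : {q : R2 | q.1 < 0} ∈ nhds p :=
          (isOpen_lt continuous_fst continuous_const).mem_nhds h
        filter_upwards [this] with q hq using hΨX q hq
      have e5 : LinearMap.det ((fderiv ℝ (fun q => Ψ (X q)) p) : R2 →ₗ[ℝ] R2) = 1 := by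
        rw [e4.fderiv_eq, fderiv_id]
        exact LinearMap.det_id
      rw [e5, hdet, one_mul] at e3
      rw [e1, e2, hdet, hdφ, ← e3]
      norm_num
    · rw [(conj_evId hK hΨ.continuous h0 hφK hΨX p h).fderiv_eq, fderiv_id]
      exact LinearMap.det_id
  · have hXid : ∀ p : R2, p.1 < -ε → X p = p := by
      intro p hp
      have := hXΨ p
      rwa [hid p hp] at this
    rw [← hφS]
    refine Set.image_congr fun p hp => ?_
    have h1 : p.1 < -ε := hS hp
    have h2 : (φ p).1 < -ε := hSbar (hφS ▸ ⟨p, hp, rfl⟩)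
    have h3 : p.1 < 0 := by linarith
    simp [conjMap, h3, hXid p h1, hid _ h2]
end
end

section
/- Let U ⊆ {(x, y) ∈ ℝ² : x < 0} and U' ⊆ {(x, y) ∈ ℝ² : x > 0} be compact sets, and let s, s' ∈ ℝ satisfy U + (s, 0) ⊆ {x < 0} and U' + (s', 0) ⊆ {x > 0}. Then there exists a compactly supported area-preserving diffeomorphism φ of ℝ² such that φ(p) = p + (s, 0) for every p ∈ U, φ(p) = p + (s', 0) for every p ∈ U', and φ maps the x-axis {(x, 0) : x ∈ ℝ} onto itself. -/
noncomputable section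

open Set Filter Topology

lemma det2 (a b c d : ℝ) (L : R2 →L[ℝ] R2)
    (h : ∀ v, L v = (a * v.1 + b * v.2, c * v.1 + d * v.2)) :
    LinearMap.det (L : R2 →ₗ[ℝ] R2) = a * d - b * c := by
  rw [← LinearMap.det_toMatrix (Module.Basis.finTwoProd ℝ), Matrix.det_fin_two]
  simp [LinearMap.toMatrix_apply, h]

lemma bij1 (k k' : ℝ → ℝ) (hk : ∀ x, HasDerivAt k (k' x) x) (hk' : ∀ x, k' x < 1)
    (M : ℝ) (hM : ∀ x, |k x| ≤ M) : Function.Bijective (fun x => x - k x) := by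
  have hd : ∀ x, HasDerivAt (fun x => x - k x) (1 - k' x) x := fun x =>
    (hasDerivAt_id x).sub (hk x)
  have hc : Continuous (fun x => x - k x) :=
    continuous_iff_continuousAt.2 fun x => (hd x).continuousAt
  refine ⟨(strictMono_of_deriv_pos fun x => ?_).injective, hc.surjective ?_ ?_⟩
  · rw [(hd x).deriv]; linarith [hk' x]
  · refine tendsto_atTop_mono (f := fun x => x - M) (fun x => ?_)
      (tendsto_atTop_add_const_right _ (-M) tendsto_id)
    have := (abs_le.1 (hM x)).2
    linarith
  · refine tendsto_atBot_mono (g := fun x => x - k x) (f := fun x => x + M) (fun x => ?_)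
      (tendsto_atBot_add_const_right _ M tendsto_id)
    have := (abs_le.1 (hM x)).1
    change x - k x ≤ x + M
    linarith

lemma smooth_inv (F : R2 → R2) (hF : ContDiff ℝ (⊤ : ℕ∞) F) (hb : Function.Bijective F)
    (hd : ∀ p, LinearMap.det ((fderiv ℝ F p) : R2 →ₗ[ℝ] R2) ≠ 0) :
    ContDiff ℝ (⊤ : ℕ∞) (Equiv.ofBijective F hb).symm := by
  have h1 : ∀ p, HasStrictFDerivAt F
      (((fderiv ℝ F p).toContinuousLinearEquivOfDetNeZero (hd p) : R2 ≃L[ℝ] R2) :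
        R2 →L[ℝ] R2) p := by
    intro p
    have := hF.contDiffAt (x := p) |>.hasStrictFDerivAt (by simp)
    exact this
  have ho : IsOpenMap F := isOpenMap_of_hasStrictFDerivAt_equiv h1
  exact ((Equiv.ofBijective F hb).toHomeomorphOfContinuousOpen hF.continuous ho).contDiff_symm
    (fun p => (h1 p).hasFDerivAt) hF

def Good (φ : R2 → R2) : Prop :=
  IsAreaDiffeo φ ∧ IsCompactSupported φ ∧ φ '' {p : R2 | p.2 = 0} = {p : R2 | p.2 = 0}

lemma invFun_eq_symm (φ : R2 → R2) (hb : Function.Bijective φ) :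
    Function.invFun φ = (Equiv.ofBijective φ hb).symm := by
  funext p
  apply hb.1
  rw [Function.rightInverse_invFun hb.2 p]
  exact ((Equiv.ofBijective φ hb).apply_symm_apply p).symm

lemma Good.comp {φ ψ : R2 → R2} (h : Good φ) (h' : Good ψ) : Good (φ ∘ ψ) := by
  obtain ⟨⟨hb, hs, hi, hd⟩, ⟨K, hK, hKe⟩, ha⟩ := h
  obtain ⟨⟨hb', hs', hi', hd'⟩, ⟨K', hK', hKe'⟩, ha'⟩ := h'
  have hdet : ∀ p, LinearMap.det ((fderiv ℝ (φ ∘ ψ) p) : R2 →ₗ[ℝ] R2) = 1 := by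
    intro p
    rw [fderiv_comp p (hs.differentiable (by simp) _) (hs'.differentiable (by simp) _),
      ContinuousLinearMap.toLinearMap_comp, LinearMap.det_comp, hd, hd', one_mul]
  refine ⟨⟨hb.comp hb', hs.comp hs', ?_, hdet⟩, ⟨K ∪ K', hK.union hK', ?_⟩, ?_⟩
  · rw [invFun_eq_symm _ (hb.comp hb')]
    exact smooth_inv _ (hs.comp hs') _ fun p => by rw [hdet]; simp
  · intro p hp
    simp only [mem_union, not_or] at hp
    simp [hKe' p hp.2, hKe p hp.1]
  · rw [image_comp, ha', ha]

lemma Good.id : Good (_root_.id) := by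
  refine ⟨⟨Function.bijective_id, contDiff_id, ?_, ?_⟩, ⟨∅, isCompact_empty, fun _ _ => rfl⟩, by simp⟩
  · rw [invFun_eq_symm _ Function.bijective_id]
    exact smooth_inv _ contDiff_id _ fun p => by simp
  · intro p
    simp

lemma Good.iterate {φ : R2 → R2} (h : Good φ) (n : ℕ) : Good (φ^[n]) := by
  induction n with
  | zero => exact Good.id
  | succ n ih => rw [Function.iterate_succ]; exact ih.comp h

/-- The basic building block, by generating functions. -/
lemma basic (c g : ℝ → ℝ) (hc : ContDiff ℝ (⊤ : ℕ∞) c) (hg : ContDiff ℝ (⊤ : ℕ∞) g)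
    (hcs : HasCompactSupport c) (hgs : HasCompactSupport g) (g0 : g 0 = 0)
    (hsm : ∀ x y, deriv g y * deriv c x < 1) :
    ∃ φ : R2 → R2, Good φ ∧ ∀ x y, φ (x - deriv g y * c x, y) = (x, y - g y * deriv c x) := by
  have hc' : ContDiff ℝ (⊤ : ℕ∞) (deriv c) := (contDiff_infty_iff_deriv.1 hc).2
  have hg' : ContDiff ℝ (⊤ : ℕ∞) (deriv g) := (contDiff_infty_iff_deriv.1 hg).2
  have hdc : ∀ x, HasDerivAt c (deriv c x) x := fun x =>
    (hc.differentiable (by simp) x).hasDerivAt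
  have hdg : ∀ x, HasDerivAt g (deriv g x) x := fun x =>
    (hg.differentiable (by simp) x).hasDerivAt
  have hdc' : ∀ x, HasDerivAt (deriv c) (deriv (deriv c) x) x := fun x =>
    (hc'.differentiable (by simp) x).hasDerivAt
  have hdg' : ∀ x, HasDerivAt (deriv g) (deriv (deriv g) x) x := fun x =>
    (hg'.differentiable (by simp) x).hasDerivAt
  obtain ⟨C, hC⟩ := hcs.exists_bound_of_continuous hc.continuous
  obtain ⟨D, hD⟩ := hgs.exists_bound_of_continuous hg.continuous
  set F : R2 → R2 := fun p => (p.1 - deriv g p.2 * c p.1, p.2) with hFdef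
  set G : R2 → R2 := fun p => (p.1, p.2 - g p.2 * deriv c p.1) with hGdef
  have hF : ContDiff ℝ (⊤ : ℕ∞) F := by
    have h1 := hg'.comp (contDiff_snd (𝕜 := ℝ) (E := ℝ) (F := ℝ))
    have h2 := hc.comp (contDiff_fst (𝕜 := ℝ) (E := ℝ) (F := ℝ))
    exact (contDiff_fst.sub (h1.mul h2)).prodMk contDiff_snd
  have hG : ContDiff ℝ (⊤ : ℕ∞) G := by
    have h1 := hg.comp (contDiff_snd (𝕜 := ℝ) (E := ℝ) (F := ℝ))
    have h2 := hc'.comp (contDiff_fst (𝕜 := ℝ) (E := ℝ) (F := ℝ))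
    exact contDiff_fst.prodMk (contDiff_snd.sub (h1.mul h2))
  have hFd : ∀ p, LinearMap.det ((fderiv ℝ F p) : R2 →ₗ[ℝ] R2) =
      1 - deriv g p.2 * deriv c p.1 := by
    intro p
    have h1 := (hdg' p.2).comp_hasFDerivAt p (hasFDerivAt_snd (𝕜 := ℝ) (E := ℝ) (F := ℝ))
    have h2 := (hdc p.1).comp_hasFDerivAt p (hasFDerivAt_fst (𝕜 := ℝ) (E := ℝ) (F := ℝ))
    have h3 := (hasFDerivAt_fst.sub (h1.mul h2)).prodMk
      (hasFDerivAt_snd (𝕜 := ℝ) (E := ℝ) (F := ℝ) (p := p))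
    have h4 : fderiv ℝ F p = _ := h3.fderiv
    rw [h4, det2 (1 - deriv g p.2 * deriv c p.1) (-(c p.1 * deriv (deriv g) p.2)) 0 1]
    · ring
    · intro v
      ext <;> simp <;> ring
  have hGd : ∀ p, LinearMap.det ((fderiv ℝ G p) : R2 →ₗ[ℝ] R2) =
      1 - deriv g p.2 * deriv c p.1 := by
    intro p
    have h1 := (hdg p.2).comp_hasFDerivAt p (hasFDerivAt_snd (𝕜 := ℝ) (E := ℝ) (F := ℝ))
    have h2 := (hdc' p.1).comp_hasFDerivAt p (hasFDerivAt_fst (𝕜 := ℝ) (E := ℝ) (F := ℝ))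
    have h3 := (hasFDerivAt_fst (𝕜 := ℝ) (E := ℝ) (F := ℝ) (p := p)).prodMk
      (hasFDerivAt_snd.sub (h1.mul h2))
    have h4 : fderiv ℝ G p = _ := h3.fderiv
    rw [h4, det2 1 0 (-(g p.2 * deriv (deriv c) p.1)) (1 - deriv g p.2 * deriv c p.1)]
    · ring
    · intro v
      ext <;> simp <;> ring
  have hpos : ∀ p : R2, 1 - deriv g p.2 * deriv c p.1 ≠ 0 := fun p =>
    (sub_pos.2 (hsm p.1 p.2)).ne'
  have bF : ∀ y, Function.Bijective (fun x => x - deriv g y * c x) := fun y =>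
    bij1 _ _ (fun x => (hdc x).const_mul (deriv g y)) (fun x => hsm x y) (|deriv g y| * C)
      fun x => by rw [abs_mul]; exact mul_le_mul_of_nonneg_left (hC x) (abs_nonneg _)
  have bG : ∀ x, Function.Bijective (fun y => y - g y * deriv c x) := fun x =>
    bij1 _ _ (fun y => (hdg y).mul_const (deriv c x)) (fun y => hsm x y) (D * |deriv c x|)
      fun y => by rw [abs_mul]; exact mul_le_mul_of_nonneg_right (hD y) (abs_nonneg _)
  have hFb : Function.Bijective F := by
    constructor
    · rintro ⟨x, y⟩ ⟨x', y'⟩ h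
      simp only [hFdef, Prod.mk.injEq] at h
      obtain ⟨h1, rfl⟩ := h
      exact Prod.ext ((bF y).1 h1) rfl
    · rintro ⟨x, y⟩
      obtain ⟨z, hz⟩ := (bF y).2 x
      exact ⟨(z, y), Prod.ext hz rfl⟩
  have hGb : Function.Bijective G := by
    constructor
    · rintro ⟨x, y⟩ ⟨x', y'⟩ h
      simp only [hGdef, Prod.mk.injEq] at h
      obtain ⟨rfl, h1⟩ := h
      exact Prod.ext rfl ((bG x).1 h1)
    · rintro ⟨x, y⟩
      obtain ⟨z, hz⟩ := (bG x).2 y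
      exact ⟨(x, z), Prod.ext rfl hz⟩
  set e := Equiv.ofBijective F hFb with he
  have hes : ContDiff ℝ (⊤ : ℕ∞) e.symm := smooth_inv F hF hFb fun p => by
    rw [hFd]; exact hpos p
  have heF : ∀ p, e.symm (F p) = p := fun p => e.symm_apply_apply p
  have hFe : ∀ p, F (e.symm p) = p := fun p => e.apply_symm_apply p
  have hφ : ContDiff ℝ (⊤ : ℕ∞) (G ∘ e.symm) := hG.comp hes
  have hb : Function.Bijective (G ∘ e.symm) := hGb.comp e.symm.bijective
  have hdet : ∀ p, LinearMap.det ((fderiv ℝ (G ∘ e.symm) p) : R2 →ₗ[ℝ] R2) = 1 := by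
    intro p
    have h1 : (F ∘ e.symm) = _root_.id := funext hFe
    have h2 := fderiv_comp p (hF.differentiable (by simp) (e.symm p))
      (hes.differentiable (by simp) p)
    rw [h1, fderiv_id] at h2
    have h3 : (1:ℝ) = LinearMap.det ((fderiv ℝ F (e.symm p)) : R2 →ₗ[ℝ] R2) *
        LinearMap.det ((fderiv ℝ e.symm p) : R2 →ₗ[ℝ] R2) := by
      rw [← LinearMap.det_comp, ← ContinuousLinearMap.toLinearMap_comp, ← h2]
      simp
    rw [fderiv_comp p (hG.differentiable (by simp) _) (hes.differentiable (by simp) _),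
      ContinuousLinearMap.toLinearMap_comp, LinearMap.det_comp, hGd, ← hFd, ← h3]
  refine ⟨G ∘ e.symm, ⟨⟨hb, hφ, ?_, hdet⟩, ⟨tsupport c ×ˢ tsupport g, hcs.prod hgs, ?_⟩, ?_⟩, ?_⟩
  · rw [invFun_eq_symm _ hb]
    exact smooth_inv _ hφ _ fun p => by rw [hdet]; simp
  · rintro ⟨x, y⟩ hp
    have key : deriv g y * c x = 0 ∧ g y * deriv c x = 0 := by
      rw [mem_prod, not_and_or] at hp
      rcases hp with hp | hp
      · have h1 : deriv c x = 0 := Function.notMem_support.1 fun h =>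
          hp (support_deriv_subset h)
        simp [h1, image_eq_zero_of_notMem_tsupport hp]
      · have h1 : deriv g y = 0 := Function.notMem_support.1 fun h =>
          hp (support_deriv_subset h)
        simp [h1, image_eq_zero_of_notMem_tsupport hp]
    have h1 : F (x, y) = (x, y) := by simp [hFdef, key.1]
    have h2 : G (x, y) = (x, y) := by simp [hGdef, key.2]
    have h3 := heF (x, y)
    rw [h1] at h3
    simp [h3, h2]
  · ext ⟨x, y⟩
    simp only [mem_image, mem_ofPred_eq, Function.comp]
    constructor
    · rintro ⟨p, hp, h⟩
      have h1 := hFe p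
      set q := e.symm p
      have h2 : (F q).2 = p.2 := by rw [h1]
      change q.2 = p.2 at h2
      have h3 := congrArg Prod.snd h
      simp only [hGdef, h2, hp, g0] at h3
      linarith
    · rintro rfl
      refine ⟨F (x, 0), rfl, ?_⟩
      rw [heF]
      simp [hGdef, g0]
  · intro x y
    have := heF (x, y)
    change G (e.symm (F (x, y))) = _
    rw [this]

lemma bump (a b : ℝ) (hab : a < b) (r : ℝ) (hr : 0 < r) :
    ∃ f : ℝ → ℝ, ContDiff ℝ (⊤ : ℕ∞) f ∧ HasCompactSupport f ∧ (∀ x ∈ Ioo a b, f x = 1) ∧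
      ∀ x, x ∉ Ioo (a - r) (b + r) → f x = 0 := by
  let f : ContDiffBump ((a + b) / 2) := ⟨(b - a) / 2, (b - a) / 2 + r, by linarith, by linarith⟩
  refine ⟨f, f.contDiff, f.hasCompactSupport, fun x hx => ?_, fun x hx => ?_⟩
  · apply f.one_of_mem_closedBall
    rw [Real.closedBall_eq_Icc]
    change x ∈ Icc ((a + b) / 2 - (b - a) / 2) ((a + b) / 2 + (b - a) / 2)
    constructor <;> linarith [hx.1, hx.2]
  · apply f.zero_of_le_dist
    by_contra h
    apply hx
    have h2 : x ∈ Metric.ball ((a + b) / 2) ((b - a) / 2 + r) := lt_of_not_ge h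
    rw [Real.ball_eq_Ioo] at h2
    constructor <;> linarith [h2.1, h2.2]

/-- Iterating the basic step translates. -/
lemma iter_translate (φ : R2 → R2) (a b R t : ℝ)
    (h : ∀ x y, x ∈ Ioo a b → y ∈ Ioo (-R) R → φ (x - t, y) = (x, y)) (x y : ℝ)
    (hy : y ∈ Ioo (-R) R) (n : ℕ) (hx : x ∈ Ioo a b) (hxn : x + n * t ∈ Ioo a b) :
    φ^[n] (x, y) = (x + n * t, y) := by
  have : ∀ k : ℕ, k ≤ n → φ^[k] (x, y) = (x + k * t, y) := by
    intro k
    induction k with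
    | zero => intro _; simp
    | succ k ih =>
      intro hk
      rw [Function.iterate_succ_apply', ih (by omega)]
      have hm : x + ((k + 1 : ℕ) : ℝ) * t ∈ Ioo a b := by
        have h1 : ((k + 1 : ℕ) : ℝ) ≤ n := by exact_mod_cast hk
        have h0 : (0 : ℝ) ≤ ((k + 1 : ℕ) : ℝ) := by positivity
        rcases le_total 0 t with ht | ht
        · have := mul_le_mul_of_nonneg_right h1 ht
          have := mul_nonneg h0 ht
          exact ⟨by linarith [hx.1], by linarith [hxn.2]⟩
        · have := mul_le_mul_of_nonpos_right h1 ht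
          have := mul_nonpos_of_nonneg_of_nonpos h0 ht
          exact ⟨by linarith [hxn.1], by linarith [hx.2]⟩
      have := h _ y hm hy
      rw [← this]
      congr 2
      push_cast; ring
  exact this n le_rfl

lemma bounds (U : Set R2) (hU : IsCompact U) (hneg : ∀ p ∈ U, 0 < p.1) (s : ℝ)
    (hs : ∀ p ∈ U, 0 < p.1 + s) : ∃ d R : ℝ, 0 < d ∧ ∀ d' R', d' ≤ d → R ≤ R' →
      ∀ p ∈ U, p.1 ∈ Ioo d' R' ∧ p.1 + s ∈ Ioo d' R' ∧ p.2 ∈ Ioo (-R') R' := by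
  rcases U.eq_empty_or_nonempty with rfl | hne
  · exact ⟨1, 1, one_pos, by simp⟩
  obtain ⟨m, hm, hmin⟩ := hU.exists_isMinOn hne continuous_fst.continuousOn
  obtain ⟨C, hC⟩ := hU.isBounded.exists_norm_le
  refine ⟨min m.1 (m.1 + s) / 2, C + |s| + 1, by
    have := hneg m hm; have := hs m hm; positivity, ?_⟩
  intro d' R' hd hR p hp
  have h0 : 0 < min m.1 (m.1 + s) := lt_min (hneg m hm) (hs m hm)
  have h1 : m.1 ≤ p.1 := hmin hp
  have h2 := min_le_left m.1 (m.1 + s)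
  have h3 := min_le_right m.1 (m.1 + s)
  have h4 := abs_le.1 ((norm_fst_le p).trans (hC p hp))
  have h5 := abs_le.1 ((norm_snd_le p).trans (hC p hp))
  have h6 := le_abs_self s
  have h7 := abs_nonneg s
  refine ⟨⟨?_, ?_⟩, ⟨?_, ?_⟩, ?_, ?_⟩ <;> linarith

/-- A compactly supported area-preserving diffeomorphism translating two compact sets
    in opposite half-planes and preserving the x-axis. -/
theorem translating_diffeo (U U' : Set R2) (hUc : IsCompact U) (hU'c : IsCompact U')
    (hU : U ⊆ {p : R2 | p.1 < 0}) (hU' : U' ⊆ {p : R2 | p.1 > 0})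
    (s s' : ℝ)
    (hs : (fun p : R2 => (p.1 + s, p.2)) '' U ⊆ {p : R2 | p.1 < 0})
    (hs' : (fun p : R2 => (p.1 + s', p.2)) '' U' ⊆ {p : R2 | p.1 > 0}) :
    ∃ φ : R2 → R2, IsAreaDiffeo φ ∧ IsCompactSupported φ ∧
      (∀ p ∈ U, φ p = (p.1 + s, p.2)) ∧
      (∀ p ∈ U', φ p = (p.1 + s', p.2)) ∧
      φ '' {p : R2 | p.2 = 0} = {p : R2 | p.2 = 0} := by
  obtain ⟨d1, R1, hd1, h1⟩ := bounds ((fun p : R2 => (-p.1, p.2)) '' U)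
    (hUc.image (by fun_prop)) (by rintro _ ⟨p, hp, rfl⟩; simpa using hU hp) (-s)
    (by
      rintro _ ⟨p, hp, rfl⟩
      have : p.1 + s < 0 := hs ⟨p, hp, rfl⟩
      simp only; linarith)
  obtain ⟨d2, R2', hd2, h2⟩ := bounds U' hU'c (fun p hp => hU' hp) s'
    (fun p hp => hs' ⟨p, hp, rfl⟩)
  obtain ⟨d, hd, hdd1, hdd2⟩ : ∃ d : ℝ, 0 < d ∧ d ≤ d1 ∧ d ≤ d2 :=
    ⟨min d1 d2, lt_min hd1 hd2, min_le_left _ _, min_le_right _ _⟩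
  obtain ⟨R, hRd, hRR1, hRR2⟩ : ∃ R : ℝ, d < R ∧ R1 ≤ R ∧ R2' ≤ R :=
    ⟨max (d + 1) (max R1 R2'), (lt_add_one d).trans_le (le_max_left _ _),
      (le_max_left _ _).trans (le_max_right _ _), (le_max_right _ _).trans (le_max_right _ _)⟩
  have hR : 0 < R := hd.trans hRd
  replace h1 := h1 d R hdd1 hRR1
  replace h2 := h2 d R hdd2 hRR2
  obtain ⟨A, hA, hAs, hA1, hA0⟩ := bump (-R) (-d) (by linarith) d hd
  obtain ⟨A', hA', hAs', hA1', hA0'⟩ := bump d R hRd d hd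
  obtain ⟨B, hB, hBs, hB1, hB0⟩ := bump (-R) R (by linarith) 1 one_pos
  set c : ℝ → ℝ := fun x => s * A x + s' * A' x with hc
  set g : ℝ → ℝ := fun y => y * B y with hg
  have hcc : ContDiff ℝ (⊤ : ℕ∞) c := (contDiff_const.mul hA).add (contDiff_const.mul hA')
  have hgc : ContDiff ℝ (⊤ : ℕ∞) g := contDiff_id.mul hB
  have hcs : HasCompactSupport c := (hAs.mul_left).add (hAs'.mul_left)
  have hgs : HasCompactSupport g := hBs.mul_left
  obtain ⟨C, hC⟩ := hcs.deriv.exists_bound_of_continuous (hcc.continuous_deriv (by simp))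
  obtain ⟨D, hD⟩ := hgs.deriv.exists_bound_of_continuous (hgc.continuous_deriv (by simp))
  have hC0 : 0 ≤ C := (norm_nonneg _).trans (hC 0)
  have hD0 : 0 ≤ D := (norm_nonneg _).trans (hD 0)
  obtain ⟨N, hN⟩ := exists_nat_gt (D * C)
  have hN0 : (0 : ℝ) < N := (mul_nonneg hD0 hC0).trans_lt hN
  have hgN : ∀ y, deriv (fun y => (N : ℝ)⁻¹ * g y) y = (N : ℝ)⁻¹ * deriv g y := fun y =>
    deriv_const_mul _ (hgc.differentiable (by simp) y)
  obtain ⟨φ, hφ, hφe⟩ := basic c (fun y => (N : ℝ)⁻¹ * g y) hcc (contDiff_const.mul hgc) hcs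
    hgs.mul_left (by simp [hg]) (by
      intro x y
      rw [hgN, mul_assoc, inv_mul_lt_iff₀ hN0, mul_one]
      refine lt_of_le_of_lt ((le_abs_self _).trans ?_) hN
      rw [abs_mul]
      exact mul_le_mul (hD y) (hC x) (abs_nonneg _) hD0)
  have hdg : ∀ y ∈ Ioo (-R) R, deriv g y = 1 := by
    intro y hy
    have : g =ᶠ[𝓝 y] fun y => y := by
      filter_upwards [isOpen_Ioo.mem_nhds hy] with z hz
      simp [hg, hB1 z hz]
    rw [this.deriv_eq]; simp
  have step : ∀ a b t, (∀ x ∈ Ioo a b, c x = t) → ∀ x y, x ∈ Ioo a b → y ∈ Ioo (-R) R →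
      φ (x - (N : ℝ)⁻¹ * t, y) = (x, y) := by
    intro a b t hct x y hx hy
    have h := hφe x y
    have hc0 : deriv c x = 0 := by
      have : c =ᶠ[𝓝 x] fun _ => t := by
        filter_upwards [isOpen_Ioo.mem_nhds hx] with z hz
        exact hct z hz
      rw [this.deriv_eq]; simp
    rw [hgN, hdg y hy, hct x hx, hc0] at h
    simpa using h
  have stepL := step (-R) (-d) s (fun x hx => by
    have : A' x = 0 := hA0' x (fun h => by linarith [h.1, hx.2])
    simp [hc, hA1 x hx, this])
  have stepR := step d R s' (fun x hx => by
    have : A x = 0 := hA0 x (fun h => by linarith [h.2, hx.1])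
    simp [hc, hA1' x hx, this])
  have hmul : ∀ t : ℝ, (N : ℝ) * ((N : ℝ)⁻¹ * t) = t := fun t =>
    mul_inv_cancel_left₀ hN0.ne' t
  have hφN := hφ.iterate N
  refine ⟨φ^[N], hφN.1, hφN.2.1, ?_, ?_, hφN.2.2⟩
  · rintro ⟨x, y⟩ hp
    obtain ⟨q1, q2, q3⟩ := h1 _ ⟨_, hp, rfl⟩
    simp only [mem_Ioo] at q1 q2 q3
    have := iter_translate φ (-R) (-d) R _ stepL x y q3 N
      ⟨by linarith, by linarith⟩ (by rw [hmul]; constructor <;> linarith)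
    rw [hmul] at this
    exact this
  · rintro ⟨x, y⟩ hp
    obtain ⟨q1, q2, q3⟩ := h2 _ hp
    have := iter_translate φ d R R _ stepR x y q3 N q1 (by rw [hmul]; exact q2)
    rw [hmul] at this
    exact this
end
end

section
/- Let H, G : ℝ × ℝ² → ℝ be infinitely differentiable with compact support, let a, b ∈ ℝ, and let σ, τ : ℝ → ℝ be infinitely differentiable with compact support such that for some open intervals V_a containing a and V_b containing b one has σ ≡ 1 and τ ≡ 0 on V_a, and σ ≡ 0 and τ ≡ 1 on V_b. Define 𝐇 : ℝ × ℝ⁴ → ℝ by 𝐇(t, (x₁, x₂, y₁, y₂)) = σ(y₂)H(t, (x₁, y₁)) + τ(y₂)G(t, (x₁, y₁)). Then: 𝐇 admits a global Hamiltonian flow Φ on ℝ⁴ and H and G admit global Hamiltonian flows φ and γ on ℝ²; the y₂-coordinate of Φ(t, p) equals the y₂-coordinate of p for all t and p; for every point p = (x₁, x₂, y₁, y₂) with y₂ ∈ V_a one has Φ(t, p) = ((φ(t, (x₁, y₁)))₁, x₂, (φ(t, (x₁, y₁)))₂, y₂) for all t; and for every point p = (x₁, x₂, y₁, y₂) with y₂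 ∈ V_b one has Φ(t, p) = ((γ(t, (x₁, y₁)))₁, x₂, (γ(t, (x₁, y₁)))₂, y₂) for all t. -/
noncomputable section

section helpers
open Set Filter Topology MeasureTheory

section nem
universe u
variable {T : Type} [TopologicalSpace T] [CompactSpace T]

/-- Superposition operator. -/
def nem {E F : Type u} [TopologicalSpace E] [TopologicalSpace F]
    (X : C(E, F)) (α : C(T, E)) : C(T, F) := X.comp α

/-- Pointwise application as a continuous linear map. -/
def mulOp (T : Type) [TopologicalSpace T] [CompactSpace T] (E F : Type u)
    [NormedAddCommGroup E] [NormedSpace ℝ E] [NormedAddCommGroup F] [NormedSpace ℝ F] :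
    C(T, E →L[ℝ] F) →L[ℝ] (C(T, E) →L[ℝ] C(T, F)) :=
  LinearMap.mkContinuous₂
    (LinearMap.mk₂ ℝ (fun (A : C(T, E →L[ℝ] F)) (h : C(T, E)) =>
        (⟨fun t => A t (h t), by fun_prop⟩ : C(T, F)))
      (by intros; ext; simp) (by intros; ext; simp) (by intros; ext; simp) (by intros; ext; simp))
    1 (by
      intro A h
      rw [ContinuousMap.norm_le _ (by positivity)]
      intro t
      rw [one_mul]
      exact ((A t).le_opNorm _).trans (mul_le_mul (A.norm_coe_le_norm t) (h.norm_coe_le_norm t)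
        (norm_nonneg _) (by positivity)))

variable {E F : Type u} [NormedAddCommGroup E] [NormedSpace ℝ E]
  [NormedAddCommGroup F] [NormedSpace ℝ F]

@[simp] lemma mulOp_apply (A : C(T, E →L[ℝ] F)) (h : C(T, E)) (t : T) :
    mulOp T E F A h t = A t (h t) := rfl

lemma nem_hasFDerivAt (X : C(E, F)) (X' : C(E, E →L[ℝ] F))
    (hX : ∀ x, HasFDerivAt X (X' x) x) (α : C(T, E)) :
    HasFDerivAt (nem (T := T) X) (mulOp T E F (nem X' α)) α := by
  rw [hasFDerivAt_iff_isLittleO, Asymptotics.isLittleO_iff]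
  intro c hc
  have hcont : Continuous (nem (T := T) X') := ContinuousMap.continuous_postcomp X'
  have := (Metric.continuous_iff (f := nem (T := T) X')).1 hcont α c hc
  obtain ⟨δ, hδ, H⟩ := this
  filter_upwards [Metric.ball_mem_nhds α hδ] with β hβ
  rw [ContinuousMap.norm_le _ (by positivity)]
  intro t
  have key : ‖X (β t) - X (α t) - (X' (α t)) (β t - α t)‖ ≤ c * ‖β t - α t‖ := by
    apply Convex.norm_image_sub_le_of_norm_hasFDerivWithin_le' (s := Metric.ball (α t) δ)
      (f' := X') (fun x _ => (hX x).hasFDerivWithinAt) _ (convex_ball _ _)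
      (Metric.mem_ball_self hδ)
    · rw [Metric.mem_ball] at hβ ⊢
      exact (ContinuousMap.dist_apply_le_dist t).trans_lt hβ
    · intro x hx
      have h1 := H (α + ContinuousMap.const T (x - α t)) (by
        rw [dist_eq_norm, add_sub_cancel_left]
        refine lt_of_le_of_lt ((ContinuousMap.norm_le _ (norm_nonneg (x - α t))).2 ?_)
          (mem_ball_iff_norm.1 hx)
        intro s; simp)
      have h2 := (ContinuousMap.dist_apply_le_dist t).trans_lt h1
      simp only [nem, ContinuousMap.comp_apply, ContinuousMap.add_apply,
        ContinuousMap.const_apply, add_sub_cancel, dist_eq_norm] at h2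
      exact h2.le
  exact key.trans (mul_le_mul_of_nonneg_left ((β - α).norm_coe_le_norm t) hc.le)

lemma nem_contDiff_nat (n : ℕ) : ∀ {F : Type u} [NormedAddCommGroup F] [NormedSpace ℝ F]
    (X : C(E, F)), ContDiff ℝ n X → ContDiff ℝ n (nem (T := T) X) := by
  induction n with
  | zero =>
    intro F _ _ X _
    exact contDiff_zero.2 (ContinuousMap.continuous_postcomp X)
  | succ n ih =>
    intro F _ _ X hX
    have hX' := (contDiff_succ_iff_fderiv (n := (n : WithTop ℕ∞))).1 (by exact_mod_cast hX)
    let X' : C(E, E →L[ℝ] F) := ⟨fderiv ℝ X, hX'.2.2.continuous⟩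
    have hd := nem_hasFDerivAt (T := T) X X' (fun x => (hX'.1 x).hasFDerivAt)
    have : ContDiff ℝ ((n : WithTop ℕ∞) + 1) (nem (T := T) X) := by
      rw [contDiff_succ_iff_fderiv]
      refine ⟨fun α => (hd α).differentiableAt, by simp, ?_⟩
      have : fderiv ℝ (nem (T := T) X) = fun α => mulOp T E F (nem X' α) :=
        funext fun α => (hd α).fderiv
      rw [this]
      exact (mulOp T E F).contDiff.comp (ih X' hX'.2.2)
    exact_mod_cast this

lemma nem_contDiff (X : C(E, F)) (hX : ContDiff ℝ (⊤ : ℕ∞) X) :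
    ContDiff ℝ (⊤ : ℕ∞) (nem (T := T) X) :=
  contDiff_infty.2 fun n => nem_contDiff_nat n X (contDiff_infty.1 hX n)

end nem

section flow
variable {E : Type} [NormedAddCommGroup E] [NormedSpace ℝ E] [CompleteSpace E]

/-- Integration from zero. -/
def intOp (E : Type) [NormedAddCommGroup E] [NormedSpace ℝ E] [CompleteSpace E] :
    C(Icc (0:ℝ) 1, E) →L[ℝ] C(Icc (0:ℝ) 1, E) :=
  LinearMap.mkContinuous
    { toFun := fun α => ⟨fun u => ∫ v in (0:ℝ)..u, α (projIcc 0 1 zero_le_one v), by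
        have : Continuous fun u : ℝ => ∫ v in (0:ℝ)..u, α (projIcc 0 1 zero_le_one v) :=
          intervalIntegral.continuous_primitive
            (fun a b => (α.continuous.comp continuous_projIcc).intervalIntegrable a b) 0
        exact this.comp continuous_subtype_val⟩
      map_add' := by
        intro α β
        ext u
        simp only [ContinuousMap.add_apply, ContinuousMap.coe_mk]
        exact intervalIntegral.integral_add
          ((α.continuous.comp continuous_projIcc).intervalIntegrable _ _)
          ((β.continuous.comp continuous_projIcc).intervalIntegrable _ _)
      map_smul' := by
        intro c α
        ext u
        simp }
    1 (by
      intro α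
      rw [ContinuousMap.norm_le _ (by positivity)]
      intro u
      have := intervalIntegral.norm_integral_le_of_norm_le_const (a := 0) (b := u.1)
        (f := fun v => α (projIcc 0 1 zero_le_one v)) (C := ‖α‖)
        (fun v _ => α.norm_coe_le_norm _)
      refine this.trans ?_
      rw [sub_zero, abs_of_nonneg u.2.1, one_mul]
      exact mul_le_of_le_one_right (norm_nonneg _) u.2.2)

lemma intOp_apply (α : C(Icc (0:ℝ) 1, E)) (u : Icc (0:ℝ) 1) :
    intOp E α u = ∫ v in (0:ℝ)..u, α (projIcc 0 1 zero_le_one v) := rfl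

lemma intOp_norm_le (α : C(Icc (0:ℝ) 1, E)) : ‖intOp E α‖ ≤ ‖α‖ := by
  have := (intOp E).le_of_opNorm_le (LinearMap.mkContinuous_norm_le _ zero_le_one _) α
  simpa using this

/-- The equation map. -/
def eqMap (X : C(E, E)) (z : (ℝ × E) × C(Icc (0:ℝ) 1, E)) : C(Icc (0:ℝ) 1, E) :=
  z.2 - ContinuousLinearMap.const ℝ (Icc (0:ℝ) 1) z.1.2 - z.1.1 • intOp E (nem X z.2)

lemma eqMap_contDiff (X : C(E, E)) (hX : ContDiff ℝ (⊤ : ℕ∞) X) :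
    ContDiff ℝ (⊤ : ℕ∞) (eqMap X) := by
  unfold eqMap
  have h1 : ContDiff ℝ (⊤ : ℕ∞) (fun z : (ℝ × E) × C(Icc (0:ℝ) 1, E) => nem X z.2) :=
    (nem_contDiff X hX).comp contDiff_snd
  have h2 := (intOp E).contDiff.comp h1 (n := (⊤ : ℕ∞))
  have h3 : ContDiff ℝ (⊤ : ℕ∞) (fun z : (ℝ × E) × C(Icc (0:ℝ) 1, E) => 
    ContinuousLinearMap.const ℝ (Icc (0:ℝ) 1) z.1.2) :=
    (ContinuousLinearMap.const (M := E) ℝ (Icc (0:ℝ) 1)).contDiff.comp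
      (contDiff_snd.comp contDiff_fst)
  exact (contDiff_snd.sub h3).sub ((contDiff_fst.comp contDiff_fst).smul h2)

lemma eqMap_invertible (X : C(E, E)) (hX : ContDiff ℝ (⊤ : ℕ∞) X) {K : NNReal}
    (hK : LipschitzWith K X) (z : (ℝ × E) × C(Icc (0:ℝ) 1, E)) (hz : |z.1.1| * K < 1) :
    (fderiv ℝ (eqMap X) z ∘L .inr ℝ (ℝ × E) C(Icc (0:ℝ) 1, E)).IsInvertible := by
  let X' : C(E, E →L[ℝ] E) := ⟨fderiv ℝ X, hX.continuous_fderiv (by simp)⟩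
  let A : C(Icc (0:ℝ) 1, E) →L[ℝ] C(Icc (0:ℝ) 1, E) :=
    z.1.1 • (intOp E ∘L mulOp (Icc (0:ℝ) 1) E E (nem X' z.2))
  have hA : ‖A‖ < 1 := by
    refine lt_of_le_of_lt (ContinuousLinearMap.opNorm_le_bound _ (by positivity) ?_) hz
    intro h
    simp only [A, smul_apply, norm_smul, Real.norm_eq_abs,
      ContinuousLinearMap.comp_apply]
    rw [mul_assoc]
    refine mul_le_mul_of_nonneg_left ((intOp_norm_le _).trans ?_) (abs_nonneg _)
    rw [ContinuousMap.norm_le _ (by positivity)]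
    intro t
    refine ((X' (z.2 t)).le_opNorm _).trans ?_
    exact mul_le_mul (norm_fderiv_le_of_lipschitz ℝ hK) (h.norm_coe_le_norm t)
        (norm_nonneg _) (NNReal.coe_nonneg _)
  have hd : HasFDerivAt (fun α => eqMap X (z.1, α)) (1 - A) z.2 := by
    have h1 := nem_hasFDerivAt (T := Icc (0:ℝ) 1) X X'
      (fun x => (hX.differentiable (by simp) x).hasFDerivAt) z.2
    have h2 := ((intOp E).hasFDerivAt.comp z.2 h1).const_smul z.1.1
    exact ((hasFDerivAt_id z.2).sub_const
      (ContinuousLinearMap.const ℝ (Icc (0:ℝ) 1) z.1.2)).sub h2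
  have hd' : HasFDerivAt (fun α => eqMap X (z.1, α))
      (fderiv ℝ (eqMap X) z ∘L .inr ℝ (ℝ × E) C(Icc (0:ℝ) 1, E)) z.2 :=
    HasFDerivAt.comp z.2 (f := fun α => (z.1, α))
      ((eqMap_contDiff X hX).differentiable (by simp) z).hasFDerivAt
      (hasFDerivAt_prodMk_right z.1 z.2)
  rw [hd'.unique hd]
  exact ⟨ContinuousLinearEquiv.ofUnit (Units.oneSub A hA), rfl⟩

lemma eqMap_unique (X : C(E, E)) {K : NNReal}
    (hK : LipschitzWith K X) (s : ℝ) (x : E) (hs : |s| * K < 1) (α β : C(Icc (0:ℝ) 1, E))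
    (hα : eqMap X ((s, x), α) = 0) (hβ : eqMap X ((s, x), β) = 0) : α = β := by
  have h1 : α - β = s • intOp E (nem X α - nem X β) := by
    simp only [eqMap, sub_eq_iff_eq_add] at hα hβ
    rw [map_sub, smul_sub]
    conv_lhs => rw [hα, hβ]
    abel
  have h2 : ‖α - β‖ ≤ |s| * K * ‖α - β‖ := by
    conv_lhs => rw [h1]
    rw [norm_smul, mul_assoc]
    refine mul_le_mul_of_nonneg_left ((intOp_norm_le _).trans ?_) (abs_nonneg _)
    rw [ContinuousMap.norm_le _ (by positivity)]
    intro t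
    have := hK.dist_le_mul (α t) (β t)
    rw [dist_eq_norm, dist_eq_norm] at this
    exact this.trans (mul_le_mul_of_nonneg_left ((α - β).norm_coe_le_norm t) (NNReal.coe_nonneg _))
  have h3 : ‖α - β‖ = 0 := by
    by_contra hne
    have : 0 < ‖α - β‖ := lt_of_le_of_ne (norm_nonneg _) (Ne.symm hne)
    nlinarith
  exact sub_eq_zero.1 (norm_eq_zero.1 h3)

lemma exists_curve (X : E → E) (hX : ContDiff ℝ (⊤ : ℕ∞) X) {K L : NNReal}
    (hK : LipschitzWith K X) (hL : ∀ x, ‖X x‖ ≤ L) (x : E) :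
    ∃ γ : ℝ → E, γ 0 = x ∧ ∀ t, HasDerivAt γ (X (γ t)) t := by
  have hv : ContMDiff (modelWithCornersSelf ℝ E) (modelWithCornersSelf ℝ E).tangent 1
      (fun x ↦ (⟨x, X x⟩ : TangentBundle (modelWithCornersSelf ℝ E) E)) :=
    contMDiff_vectorSpace_iff_contDiff.2 (hX.of_le (by exact_mod_cast le_top))
  obtain ⟨γ, h0, hγ⟩ := (exists_isMIntegralCurve_iff_exists_isMIntegralCurveOn_Ioo
    (v := X) hv x).2 (by
    intro a
    by_cases ha : 0 < a
    · have hPL : IsPicardLindelof (fun _ => X) (tmin := -a) (tmax := a)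
          ⟨0, by constructor <;> linarith⟩ x (L * ⟨a, ha.le⟩) 0 L K :=
        { lipschitzOnWith := fun _ _ => hK.lipschitzOnWith
          continuousOn := fun _ _ => continuousOn_const
          norm_le := fun _ _ y _ => hL y
          mul_max_le := by simp; exact le_rfl }
      obtain ⟨γ, h0, hγ⟩ := hPL.exists_eq_forall_mem_Icc_hasDerivWithinAt₀
      refine ⟨γ, h0, fun t ht => ?_⟩
      exact HasFDerivWithinAt.hasMFDerivWithinAt ((hγ t (Ioo_subset_Icc_self ht)).mono Ioo_subset_Icc_self).hasFDerivWithinAt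
    · refine ⟨fun _ => x, rfl, fun t ht => ?_⟩
      exfalso
      have := ht.1.trans ht.2
      linarith)
  refine ⟨γ, h0, fun t => ?_⟩
  have h1 : HasFDerivAt γ ((1 : ℝ →L[ℝ] ℝ).smulRight (X (γ t))) t :=
    HasMFDerivAt.hasFDerivAt (hγ t)
  simpa using h1.hasDerivAt


lemma curve_unique (X : E → E) {K : NNReal} (hK : LipschitzWith K X) (f g : ℝ → E)
    (hf : ∀ t, HasDerivAt f (X (f t)) t) (hg : ∀ t, HasDerivAt g (X (g t)) t)
    (h : f 0 = g 0) : f = g :=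
  ODE_solution_unique_univ (v := fun _ => X) (s := fun _ => univ) (K := K)
    (fun _ => hK.lipschitzOnWith) (fun t => ⟨hf t, trivial⟩) (fun t => ⟨hg t, trivial⟩) h

lemma flow_small (X : C(E, E)) (hX : ContDiff ℝ (⊤ : ℕ∞) X) {K : NNReal}
    (hK : LipschitzWith K X) (Φ : ℝ × E → E) (h0 : ∀ x, Φ (0, x) = x)
    (hd : ∀ t x, HasDerivAt (fun s => Φ (s, x)) (X (Φ (t, x))) t)
    (z : ℝ × E) (hz : |z.1| * K < 1) : ContDiffAt ℝ (⊤ : ℕ∞) Φ z := by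
  have hcont : ∀ x, Continuous (fun s => Φ (s, x)) := fun x =>
    continuous_iff_continuousAt.2 fun t => (hd t x).continuousAt
  let β : ℝ × E → C(Icc (0:ℝ) 1, E) := fun w =>
    ⟨fun u => Φ (w.1 * u, w.2), (hcont w.2).comp (by fun_prop)⟩
  have hβ : ∀ w : ℝ × E, eqMap X (w, β w) = 0 := by
    intro w
    ext u
    have h1 : ∫ v in (0:ℝ)..u, w.1 • X (Φ (w.1 * v, w.2)) = Φ (w.1 * u, w.2) - w.2 := by
      rw [intervalIntegral.integral_eq_sub_of_hasDerivAt (f := fun v => Φ (w.1 * v, w.2))]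
      · simp [h0]
      · intro v _
        have := (hd (w.1 * v) w.2).scomp v ((hasDerivAt_id v).const_mul w.1)
        simpa [Function.comp_def] using this
      · apply Continuous.intervalIntegrable
        have := hcont w.2
        have h2 : Continuous fun v : ℝ => Φ (w.1 * v, w.2) := this.comp (by fun_prop)
        exact (X.continuous.comp h2).const_smul w.1
    have h2 : intOp E (nem X (β w)) u = ∫ v in (0:ℝ)..u, X (Φ (w.1 * v, w.2)) := by
      rw [intOp_apply]
      apply intervalIntegral.integral_congr
      intro v hv
      rw [uIcc_of_le u.2.1] at hv
      have hv' : v ∈ Icc (0:ℝ) 1 := ⟨hv.1, hv.2.trans u.2.2⟩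
      simp only [nem, ContinuousMap.comp_apply, projIcc_of_mem zero_le_one hv']
      rfl
    rw [intervalIntegral.integral_smul] at h1
    change Φ (w.1 * u, w.2) - w.2 - w.1 • intOp E (nem X (β w)) u = 0
    rw [h2, h1, sub_self]
  have cd : ContDiffAt ℝ (⊤ : ℕ∞) (eqMap X) (z, β z) := (eqMap_contDiff X hX).contDiffAt
  have hinv := eqMap_invertible X hX hK (z, β z) hz
  have hn : ((⊤ : ℕ∞) : WithTop ℕ∞) ≠ 0 := by simp
  have hg := cd.contDiffAt_implicitFunction hn hinv
  have he := cd.eventually_apply_implicitFunction hn hinv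
  have hev : ∀ᶠ w : ℝ × E in 𝓝 z, |w.1| * K < 1 := by
    have : Continuous fun w : ℝ × E => |w.1| * (K : ℝ) := by fun_prop
    exact this.continuousAt.eventually_lt continuousAt_const hz
  let ev : C(Icc (0:ℝ) 1, E) →L[ℝ] E := ContinuousMap.evalCLM ℝ ⟨1, by simp⟩
  have h3 : ContDiffAt ℝ (⊤ : ℕ∞) (fun w => ev (cd.implicitFunction hn hinv w)) z :=
    ev.contDiff.contDiffAt.comp z hg
  refine h3.congr_of_eventuallyEq ?_
  filter_upwards [he, hev] with w hw1 hw2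
  rw [hβ z] at hw1
  have := eqMap_unique X hK w.1 w.2 hw2 _ _ hw1 (hβ w)
  rw [this]
  change Φ w = Φ (w.1 * 1, w.2)
  rw [mul_one]

theorem exists_flow (X : E → E) (hX : ContDiff ℝ (⊤ : ℕ∞) X) {K L : NNReal}
    (hK : LipschitzWith K X) (hL : ∀ x, ‖X x‖ ≤ L) :
    ∃ Φ : ℝ × E → E, ContDiff ℝ (⊤ : ℕ∞) Φ ∧ (∀ x, Φ (0, x) = x) ∧
      ∀ t x, HasDerivAt (fun s => Φ (s, x)) (X (Φ (t, x))) t := by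
  choose γ h0 hd using exists_curve X hX hK hL
  let Φ : ℝ × E → E := fun z => γ z.2 z.1
  have hgrp : ∀ s t x, Φ (s + t, x) = Φ (s, Φ (t, x)) := by
    intro s t x
    have := curve_unique X hK (fun s => γ x (s + t)) (γ (γ x t))
      (fun s => (hd x (s + t)).comp_add_const s t) (hd _) (by simp [h0])
    exact congrFun this s
  have hsm : ∀ n : ℕ, ∀ z : ℝ × E, |z.1| * K < 2 ^ n → ContDiffAt ℝ (⊤ : ℕ∞) Φ z := by
    intro n
    induction n with
    | zero =>
      intro z hz
      exact flow_small ⟨X, hX.continuous⟩ hX hK Φ h0 (fun t x => hd x t) z (by simpa using hz)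
    | succ n ih =>
      intro z hz
      have hhalf : |z.1 / 2| * K < 2 ^ n := by
        rw [abs_div, abs_two]; rw [pow_succ] at hz; linarith
      have e : Φ = fun z => Φ (z.1 / 2, Φ (z.1 / 2, z.2)) := by
        funext z
        rw [← hgrp, add_halves]
      rw [e]
      have h1 : ContDiffAt ℝ (⊤ : ℕ∞) (fun z : ℝ × E => Φ (z.1 / 2, z.2)) z :=
        (ih (z.1 / 2, z.2) hhalf).comp (f := fun z : ℝ × E => (z.1 / 2, z.2)) z
          ((contDiff_fst.div_const 2).prodMk contDiff_snd).contDiffAt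
      exact (ih (z.1 / 2, Φ (z.1 / 2, z.2)) hhalf).comp
        (f := fun z : ℝ × E => (z.1 / 2, Φ (z.1 / 2, z.2))) z
          ((contDiff_fst.div_const 2).contDiffAt.prodMk h1)
  refine ⟨Φ, contDiff_iff_contDiffAt.2 fun z => ?_, h0, fun t x => hd x t⟩
  obtain ⟨n, hn⟩ := pow_unbounded_of_one_lt (|z.1| * K) (one_lt_two)
  exact hsm n z hn

theorem exists_flow_t (v : ℝ × E → E) (hv : ContDiff ℝ (⊤ : ℕ∞) v) {K L : NNReal}
    (hK : LipschitzWith K v) (hL : ∀ x, ‖v x‖ ≤ L) :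
    ∃ Φ : ℝ × E → E, ContDiff ℝ (⊤ : ℕ∞) Φ ∧ (∀ x, Φ (0, x) = x) ∧
      ∀ t x, HasDerivAt (fun s => Φ (s, x)) (v (t, Φ (t, x))) t := by
  obtain ⟨Φ, h1, h2, h3⟩ := exists_flow (E := ℝ × E) (fun z => ((1 : ℝ), v z))
    (contDiff_const.prodMk hv) (K := max 0 K) (L := max 1 L)
    ((LipschitzWith.const (1 : ℝ)).prodMk hK) (by
      intro z
      rw [Prod.norm_mk]
      push_cast
      exact max_le_max (by simp) (hL z))
  have hfst : ∀ t x, (Φ (t, (0, x))).1 = t := by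
    intro t x
    have hd : ∀ s, HasDerivAt (fun s => (Φ (s, ((0 : ℝ), x))).1 - s) 0 s := by
      intro s
      have h4 : HasDerivAt (fun s => (Φ (s, ((0 : ℝ), x))).1) 1 s :=
        (ContinuousLinearMap.fst ℝ ℝ E).hasFDerivAt.comp_hasDerivAt s (h3 s (0, x))
      have h5 := h4.sub (hasDerivAt_id s)
      rw [sub_self] at h5
      exact h5
    have := is_const_of_deriv_eq_zero (fun s => (hd s).differentiableAt) (fun s => (hd s).deriv) t 0
    simp only [h2] at this
    linarith
  refine ⟨fun z => (Φ (z.1, (0, z.2))).2, ?_, fun x => by simp [h2], fun t x => ?_⟩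
  · exact contDiff_snd.comp (h1.comp (contDiff_fst.prodMk (contDiff_const.prodMk contDiff_snd)))
  · have := (h3 t (0, x)).snd
    have e : Φ (t, (0, x)) = (t, (Φ (t, (0, x))).2) := Prod.ext (hfst t x) rfl
    change HasDerivAt (fun s => (Φ (s, (0, x))).2) (v (t, (Φ (t, (0, x))).2)) t
    rw [← e]
    exact this

end flow

section ham

lemma nice_field {V W F : Type} [NormedAddCommGroup V] [NormedSpace ℝ V] 
    [NormedAddCommGroup W] [NormedSpace ℝ W] [NormedAddCommGroup F] [NormedSpace ℝ F]
    (k : V → ℝ) (hk : ContDiff ℝ (⊤ : ℕ∞) k) (hc : HasCompactSupport k)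
    (P : W →L[ℝ] V) (A : (V →L[ℝ] ℝ) →L[ℝ] F) :
    ContDiff ℝ (⊤ : ℕ∞) (fun w => A (fderiv ℝ k (P w))) ∧
    (∃ K : NNReal, LipschitzWith K (fun w => A (fderiv ℝ k (P w)))) ∧
    ∃ L : NNReal, ∀ w, ‖A (fderiv ℝ k (P w))‖ ≤ L := by
  have h1 : ContDiff ℝ (⊤ : ℕ∞) (fderiv ℝ k) := hk.fderiv_right (by simp)
  have h2 : HasCompactSupport (fderiv ℝ k) := hc.fderiv ℝ
  refine ⟨A.contDiff.comp (h1.comp P.contDiff), ?_, ?_⟩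
  · obtain ⟨C, hC⟩ := h1.lipschitzWith_of_hasCompactSupport h2 (by simp)
    exact ⟨_, A.lipschitz.comp (hC.comp P.lipschitz)⟩
  · obtain ⟨C, hC⟩ := h2.exists_bound_of_continuous h1.continuous
    refine ⟨‖A‖₊ * C.toNNReal, fun w => ?_⟩
    refine (A.le_opNorm _).trans ?_
    push_cast
    refine mul_le_mul_of_nonneg_left ((hC _).trans (Real.le_coe_toNNReal C)) (norm_nonneg _)

lemma fderiv_slice {V W : Type} [NormedAddCommGroup V] [NormedSpace ℝ V] 
    [NormedAddCommGroup W] [NormedSpace ℝ W]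
    (k : V → ℝ) (hk : ContDiff ℝ (⊤ : ℕ∞) k) (P : ℝ × W →L[ℝ] V) (t : ℝ) (p u : W) :
    fderiv ℝ (fun q => k (P (t, q))) p u = fderiv ℝ k (P (t, p)) (P (0, u)) := by
  have h : HasFDerivAt (fun q => k (P (t, q)))
      ((fderiv ℝ k (P (t, p))).comp (P.comp (.inr ℝ ℝ W))) p :=
    HasFDerivAt.comp p (hk.differentiable (by simp) _).hasFDerivAt
      (P.hasFDerivAt.comp p (hasFDerivAt_prodMk_right t p))
  rw [h.fderiv]
  rfl

/-- Evaluation of functionals at a vector. -/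
abbrev evA {V : Type} [NormedAddCommGroup V] [NormedSpace ℝ V] (u : V) : (V →L[ℝ] ℝ) →L[ℝ] ℝ :=
  ContinuousLinearMap.apply ℝ ℝ u

lemma flow2 (H : ℝ × R2 → ℝ) (hH : ContDiff ℝ (⊤ : ℕ∞) H) (hHc : HasCompactSupport H) :
    ∃ φ, IsHamFlow2t H φ := by
  obtain ⟨h1, ⟨K, h2⟩, ⟨L, h3⟩⟩ := nice_field H hH hHc (.id ℝ (ℝ × R2))
    ((evA (0, (0, 1))).prod (-(evA (0, (1, 0)))))
  obtain ⟨φ, a1, a2, a3⟩ := exists_flow_t _ h1 h2 h3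
  refine ⟨φ, a1, a2, fun t q => ?_⟩
  have : ∀ u : R2, fderiv ℝ (fun r => H (t, r)) (φ (t, q)) u = fderiv ℝ H (t, φ (t, q)) (0, u) :=
    fderiv_slice H hH (.id ℝ (ℝ × R2)) t (φ (t, q))
  rw [HamVF2t, this, this]
  exact a3 t q

lemma flow4 (k : ℝ × (ℝ × (ℝ × ℝ)) → ℝ) (hk : ContDiff ℝ (⊤ : ℕ∞) k) (hc : HasCompactSupport k) :
    ∃ Φ, IsHamFlow4t (fun tp : ℝ × R4 => k (tp.1, (tp.2.1, (tp.2.2.2.1, tp.2.2.2.2)))) Φ ∧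
      (∀ t p, (Φ (t, p)).2.2.2 = p.2.2.2) ∧
      ∃ K : NNReal, ∀ t, LipschitzWith K
        (HamVF4t (fun tp : ℝ × R4 => k (tp.1, (tp.2.1, (tp.2.2.2.1, tp.2.2.2.2)))) t) := by
  let P : ℝ × R4 →L[ℝ] ℝ × (ℝ × (ℝ × ℝ)) :=
    let f := ContinuousLinearMap.fst ℝ ℝ R4
    let s := ContinuousLinearMap.snd ℝ ℝ R4
    let s2 := (ContinuousLinearMap.snd ℝ ℝ (ℝ × ℝ)).comp (ContinuousLinearMap.snd ℝ ℝ (ℝ × ℝ × ℝ))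
    f.prod (((ContinuousLinearMap.fst ℝ ℝ (ℝ × ℝ × ℝ)).comp s).prod (s2.comp s))
  have hP : ∀ tp, P tp = (tp.1, (tp.2.1, (tp.2.2.2.1, tp.2.2.2.2))) := fun _ => rfl
  obtain ⟨h1, ⟨K, h2⟩, ⟨L, h3⟩⟩ := nice_field k hk hc P
    ((evA (P (0, (0, 0, 1, 0)))).prod ((evA (P (0, (0, 0, 0, 1)))).prod
      ((-(evA (P (0, (1, 0, 0, 0))))).prod (-(evA (P (0, (0, 1, 0, 0))))))))
  have key : ∀ t p, HamVF4t (fun tp : ℝ × R4 => k (tp.1, (tp.2.1, (tp.2.2.2.1, tp.2.2.2.2)))) t p =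
      ((evA (P (0, (0, 0, 1, 0)))).prod ((evA (P (0, (0, 0, 0, 1)))).prod
      ((-(evA (P (0, (1, 0, 0, 0))))).prod (-(evA (P (0, (0, 1, 0, 0)))))))) 
        (fderiv ℝ k (P (t, p))) := by
    intro t p
    have := fderiv_slice k hk P t p
    simp only [hP] at this
    simp [HamVF4t, this, hP]
  obtain ⟨Φ, a1, a2, a3⟩ := exists_flow_t _ h1 h2 h3
  have a4 : ∀ (t : ℝ) (p : R4), HasDerivAt (fun s => Φ (s, p)) (HamVF4t
      (fun tp : ℝ × R4 => k (tp.1, (tp.2.1, (tp.2.2.2.1, tp.2.2.2.2)))) t (Φ (t, p))) t := by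
    intro t p
    rw [key]
    exact a3 t p
  refine ⟨Φ, ⟨a1, a2, a4⟩, ?_, K, ?_⟩
  · intro t p
    let pr : R4 →L[ℝ] ℝ := (ContinuousLinearMap.snd ℝ ℝ ℝ).comp
      ((ContinuousLinearMap.snd ℝ ℝ (ℝ × ℝ)).comp (ContinuousLinearMap.snd ℝ ℝ (ℝ × ℝ × ℝ)))
    have hd : ∀ s, HasDerivAt (fun s => pr (Φ (s, p))) 0 s := by
      intro s
      have h5 := pr.hasFDerivAt.comp_hasDerivAt s (a4 s p)
      have h6 : pr (HamVF4t (fun tp : ℝ × R4 => k (tp.1, (tp.2.1, (tp.2.2.2.1, tp.2.2.2.2))))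
          s (Φ (s, p))) = 0 := by
        rw [key]
        simp only [pr, hP]
        change -(fderiv ℝ k _ (0, 0, 0, 0)) = 0
        rw [neg_eq_zero]
        exact map_zero _
      rw [h6] at h5
      exact h5
    have := is_const_of_deriv_eq_zero (fun s => (hd s).differentiableAt) (fun s => (hd s).deriv) t 0
    simp only [a2] at this
    exact this
  · intro t
    have e : HamVF4t (fun tp : ℝ × R4 => k (tp.1, (tp.2.1, (tp.2.2.2.1, tp.2.2.2.2)))) t = 
        fun p => _ := funext (key t)
    rw [e]
    have := h2.comp (LipschitzWith.prodMk_left (β := R4) t)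
    rw [mul_one] at this
    exact this

lemma restrict (k : ℝ × R4 → ℝ) (Φ : ℝ × R4 → R4) (hΦ : IsHamFlow4t k Φ) {K : NNReal}
    (hK : ∀ t, LipschitzWith K (HamVF4t k t)) (H : ℝ × R2 → ℝ) (hH : ContDiff ℝ (⊤ : ℕ∞) H)
    (φ : ℝ × R2 → R2)
    (hφ : IsHamFlow2t H φ) (a b : ℝ)
    (hk : ∀ t (p : R4), p.2.2.2 ∈ Ioo a b → k (t, p) = H (t, (p.1, p.2.2.1)))
    (t : ℝ) (p : R4) (hp : p.2.2.2 ∈ Ioo a b) :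
    Φ (t, p) = ((φ (t, (p.1, p.2.2.1))).1, p.2.1, (φ (t, (p.1, p.2.2.1))).2, p.2.2.2) := by
  have hvf : ∀ t (q : R4), q.2.2.2 ∈ Ioo a b → HamVF4t k t q =
      ((HamVF2t H t (q.1, q.2.2.1)).1, 0, (HamVF2t H t (q.1, q.2.2.1)).2, 0) := by
    intro t q hq
    let P : R4 →L[ℝ] R2 := (ContinuousLinearMap.fst ℝ ℝ (ℝ × ℝ × ℝ)).prod
      ((ContinuousLinearMap.fst ℝ ℝ ℝ).comp
      ((ContinuousLinearMap.snd ℝ ℝ (ℝ × ℝ)).comp (ContinuousLinearMap.snd ℝ ℝ (ℝ × ℝ × ℝ))))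
    have hP : ∀ p, P p = (p.1, p.2.2.1) := fun _ => rfl
    have hd : DifferentiableAt ℝ (fun r => H (t, r)) (P q) :=
      (hH.comp (contDiff_const.prodMk contDiff_id)).differentiable (by simp) _
    have h1 : HasFDerivAt (fun r => H (t, P r)) ((fderiv ℝ (fun r => H (t, r)) (P q)).comp P) q :=
      HasFDerivAt.comp q hd.hasFDerivAt P.hasFDerivAt
    have hev : (fun r => k (t, r)) =ᶠ[𝓝 q] fun r => H (t, P r) := by
      have hc : Continuous fun r : R4 => r.2.2.2 := by fun_prop
      filter_upwards [hc.continuousAt.preimage_mem_nhds (isOpen_Ioo.mem_nhds hq)] with r hr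
      exact hk t r hr
    have h2 := (h1.congr_of_eventuallyEq hev).fderiv
    have z : ((0 : ℝ), (0 : ℝ)) = 0 := rfl
    simp [HamVF4t, HamVF2t, h2, hP, z]
  have := ODE_solution_unique_univ (v := HamVF4t k) (s := fun _ => univ) (K := K) (t₀ := 0)
    (f := fun t => Φ (t, p))
    (g := fun t => ((φ (t, (p.1, p.2.2.1))).1, p.2.1, (φ (t, (p.1, p.2.2.1))).2, p.2.2.2))
    (fun t => (hK t).lipschitzOnWith) (fun t => ⟨hΦ.2.2 t p, trivial⟩) (fun t => ⟨?_, trivial⟩)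
    (by simp [hΦ.2.1, hφ.2.1])
  · exact congrFun this t
  · rw [hvf t ((φ (t, (p.1, p.2.2.1))).1, p.2.1, (φ (t, (p.1, p.2.2.1))).2, p.2.2.2) hp]
    have h := hφ.2.2 t (p.1, p.2.2.1)
    have ha : HasDerivAt (fun s => (φ (s, (p.1, p.2.2.1))).1) _ t :=
      (ContinuousLinearMap.fst ℝ ℝ ℝ).hasFDerivAt.comp_hasDerivAt t h
    have hb : HasDerivAt (fun s => (φ (s, (p.1, p.2.2.1))).2) _ t :=
      (ContinuousLinearMap.snd ℝ ℝ ℝ).hasFDerivAt.comp_hasDerivAt t h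
    exact ha.prodMk ((hasDerivAt_const t _).prodMk (hb.prodMk (hasDerivAt_const t _)))

lemma cut_compact (H : ℝ × R2 → ℝ) (hHc : HasCompactSupport H) (σ : ℝ → ℝ)
    (hσc : HasCompactSupport σ) :
    HasCompactSupport (fun z : ℝ × (ℝ × (ℝ × ℝ)) => σ z.2.2.2 * H (z.1, (z.2.1, z.2.2.1))) := by
  let j : (ℝ × R2) × ℝ → ℝ × (ℝ × (ℝ × ℝ)) := fun w => (w.1.1, (w.1.2.1, (w.1.2.2, w.2)))
  have hj : Continuous j := by fun_prop
  refine HasCompactSupport.intro ((hHc.isCompact.prod hσc.isCompact).image hj) ?_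
  intro z hz
  by_contra hne
  apply hz
  refine ⟨((z.1, (z.2.1, z.2.2.1)), z.2.2.2), ⟨?_, ?_⟩, rfl⟩
  · exact subset_tsupport _ (right_ne_zero_of_mul hne)
  · exact subset_tsupport _ (left_ne_zero_of_mul hne)

lemma cut_contDiff (H : ℝ × R2 → ℝ) (hH : ContDiff ℝ (⊤ : ℕ∞) H) (σ : ℝ → ℝ)
    (hσ : ContDiff ℝ (⊤ : ℕ∞) σ) :
    ContDiff ℝ (⊤ : ℕ∞)
      (fun z : ℝ × (ℝ × (ℝ × ℝ)) => σ z.2.2.2 * H (z.1, (z.2.1, z.2.2.1))) := by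
  fun_prop

end ham

end helpers

/-- The cut-off Hamiltonian 𝐇(t,p) = σ(y₂)H(t,(x₁,y₁)) + τ(y₂)G(t,(x₁,y₁)) has a global
    flow that preserves y₂ and restricts to the flows of H and G near the levels a and b. -/
theorem cutoff_hamiltonian_flow (H G : ℝ × R2 → ℝ)
    (hH : ContDiff ℝ (⊤ : ℕ∞) H) (hHc : HasCompactSupport H)
    (hG : ContDiff ℝ (⊤ : ℕ∞) G) (hGc : HasCompactSupport G)
    (a b : ℝ) (σ τ : ℝ → ℝ)
    (hσ : ContDiff ℝ (⊤ : ℕ∞) σ) (hσc : HasCompactSupport σ)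
    (hτ : ContDiff ℝ (⊤ : ℕ∞) τ) (hτc : HasCompactSupport τ)
    (a₁ a₂ b₁ b₂ : ℝ) (ha : a ∈ Set.Ioo a₁ a₂) (hb : b ∈ Set.Ioo b₁ b₂)
    (hσa : ∀ y ∈ Set.Ioo a₁ a₂, σ y = 1) (hτa : ∀ y ∈ Set.Ioo a₁ a₂, τ y = 0)
    (hσb : ∀ y ∈ Set.Ioo b₁ b₂, σ y = 0) (hτb : ∀ y ∈ Set.Ioo b₁ b₂, τ y = 1) :
    ∃ (Φ : ℝ × R4 → R4) (φ γ : ℝ × R2 → R2),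
      IsHamFlow4t
        (fun tp : ℝ × R4 =>
          σ tp.2.2.2.2 * H (tp.1, (tp.2.1, tp.2.2.2.1)) +
          τ tp.2.2.2.2 * G (tp.1, (tp.2.1, tp.2.2.2.1))) Φ ∧
      IsHamFlow2t H φ ∧ IsHamFlow2t G γ ∧
      (∀ (t : ℝ) (p : R4), (Φ (t, p)).2.2.2 = p.2.2.2) ∧
      (∀ (t : ℝ) (p : R4), p.2.2.2 ∈ Set.Ioo a₁ a₂ →
        Φ (t, p) = ((φ (t, (p.1, p.2.2.1))).1, p.2.1, (φ (t, (p.1, p.2.2.1))).2, p.2.2.2)) ∧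
      (∀ (t : ℝ) (p : R4), p.2.2.2 ∈ Set.Ioo b₁ b₂ →
        Φ (t, p) = ((γ (t, (p.1, p.2.2.1))).1, p.2.1, (γ (t, (p.1, p.2.2.1))).2, p.2.2.2)) := by
  obtain ⟨φ, hφ⟩ := flow2 H hH hHc
  obtain ⟨γ, hγ⟩ := flow2 G hG hGc
  obtain ⟨Φ, hΦ, hy, K, hK⟩ := flow4 _
    ((cut_contDiff H hH σ hσ).add (cut_contDiff G hG τ hτ))
    ((cut_compact H hHc σ hσc).add (cut_compact G hGc τ hτc))
  refine ⟨Φ, φ, γ, hΦ, hφ, hγ, hy, fun t p hp => ?_, fun t p hp => ?_⟩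
  · exact restrict _ Φ hΦ hK H hH φ hφ a₁ a₂ (fun t q hq => by simp [hσa _ hq, hτa _ hq]) t p hp
  · exact restrict _ Φ hΦ hK G hG γ hγ b₁ b₂ (fun t q hq => by simp [hσb _ hq, hτb _ hq]) t p hp
end
end
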